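/- (Blow-up criterion for nonnegative solutions) Let w be a nonnegative solution of ∂_s w = Δw − (1/2) y·∇w − w + w² on R² (the similarity-variables equation with p = 2), and suppose that for some s₁ ∈ R, w_{0,0}(s₁) := ∫_{R²} w(y,s₁) ρ(y) dy > 1. Then w cannot be defined for all (y,s) ∈ R² × [s₁, ∞). -/

import Mathlib

noncomputable section

open Real MeasureTheory Filter Topology Asymptotics

/-- The rescaled Hermite polynomial `h_j(ξ) = Σ_{i=0}^{⌊j/2⌋} (j!/(i!(j−2i)!)) (−1)^i ξ^{j−2i}`. -/
def hq (j : ℕ) (x : ℝ) : ℝ :=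
  ∑ i ∈ Finset.range (j / 2 + 1),
    ((Nat.factorial j : ℝ) / ((Nat.factorial i : ℝ) * (Nat.factorial (j - 2 * i) : ℝ))) *
      (-1 : ℝ) ^ i * x ^ (j - 2 * i)

/-- The Gaussian weight `ρ(y) = e^{-|y|²/4}/(4π)` on `ℝ²`. -/
def rho2 (y : Fin 2 → ℝ) : ℝ :=
  Real.exp (-(y 0 ^ 2 + y 1 ^ 2) / 4) / (4 * Real.pi)

/-- The weighted `L^q_ρ` norm on `ℝ²`. -/
def wnorm (q : ℝ) (f : (Fin 2 → ℝ) → ℝ) : ℝ :=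
  (∫ y : Fin 2 → ℝ, |f y| ^ q * rho2 y) ^ (1 / q)

/-- Partial derivative in the `i`-th coordinate direction. -/
def pd (f : (Fin 2 → ℝ) → ℝ) (i : Fin 2) (x : Fin 2 → ℝ) : ℝ :=
  fderiv ℝ f x (Pi.single i 1)

/-- Laplacian on `ℝ²`. -/
def lap2 (f : (Fin 2 → ℝ) → ℝ) (x : Fin 2 → ℝ) : ℝ :=
  ∑ i : Fin 2, pd (fun z => pd f i z) i x

/-- `u` is a classical solution of `∂_t u = Δu + u²` on `[0, T)`. -/
def IsHeatSol (u : ℝ → (Fin 2 → ℝ) → ℝ) (T : ℝ) : Prop :=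
  ∀ t ∈ Set.Ico (0 : ℝ) T, ∀ x,
    HasDerivAt (fun τ => u τ x) (lap2 (u t) x + (u t x) ^ 2) t

/-- `a` is a blow-up point of `u` at time `T`: `|u(a,t)| → ∞` as `t → T⁻`. -/
def IsBlowupPt (u : ℝ → (Fin 2 → ℝ) → ℝ) (T : ℝ) (a : Fin 2 → ℝ) : Prop :=
  Tendsto (fun t => |u t a|) (nhdsWithin T (Set.Iio T)) atTop

/-- `u` blows up at time `T`: it is bounded before `T` and has a blow-up point at `T`. -/
def BlowsUpAt (u : ℝ → (Fin 2 → ℝ) → ℝ) (T : ℝ) : Prop :=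
  (∀ t ∈ Set.Ico (0 : ℝ) T, ∃ C, ∀ x, |u t x| ≤ C) ∧ ∃ a, IsBlowupPt u T a

/-- Similarity variables: `w_a(y,s) = (T-t) u(x,t)`, `y = (x-a)/√(T-t)`, `s = -log(T-t)`
(case `p = 2`, so `(T-t)^{1/(p-1)} = T-t = e^{-s}`). -/
def simw (u : ℝ → (Fin 2 → ℝ) → ℝ) (T : ℝ) (a : Fin 2 → ℝ) (s : ℝ) (y : Fin 2 → ℝ) : ℝ :=
  Real.exp (-s) * u (T - Real.exp (-s)) (fun i => a i + Real.exp (-s / 2) * y i)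

/-- `a` is a non-isolated blow-up point of `u` at time `T`. -/
def NonIsolatedBlowup (u : ℝ → (Fin 2 → ℝ) → ℝ) (T : ℝ) (a : Fin 2 → ℝ) : Prop :=
  IsBlowupPt u T a ∧ ∀ ε > 0, ∃ b, b ≠ a ∧ dist b a < ε ∧ IsBlowupPt u T b

/-- Profile order `m ≥ 4` at the blow-up point `a`, with coefficients `C j`, `0 ≤ j ≤ m`:
`w_a(y,s) - 1 ∼ e^{-(m/2-1)s} Σ_{j=0}^m C_j h_{m-j}(y₁) h_j(y₂)` in `L²_ρ` as `s → ∞`,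
where the multilinear form `Σ_j C_j y₁^{m-j} y₂^j` is nonzero and nonpositive. -/
def ProfileOrder (u : ℝ → (Fin 2 → ℝ) → ℝ) (T : ℝ) (a : Fin 2 → ℝ) (m : ℕ) (C : ℕ → ℝ) :
    Prop :=
  ((fun s => wnorm 2 (fun y => simw u T a s y - 1 -
      Real.exp (-((m : ℝ) / 2 - 1) * s) *
        ∑ j ∈ Finset.range (m + 1), C j * hq (m - j) (y 0) * hq j (y 1))) =o[atTop]
    fun s => Real.exp (-((m : ℝ) / 2 - 1) * s)) ∧
  (∀ y : Fin 2 → ℝ, (∑ j ∈ Finset.range (m + 1), C j * (y 0) ^ (m - j) * (y 1) ^ j) ≤ 0) ∧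
  (∃ y : Fin 2 → ℝ, (∑ j ∈ Finset.range (m + 1), C j * (y 0) ^ (m - j) * (y 1) ^ j) ≠ 0)


abbrev E2 := Fin 2 → ℝ

def Lop (g : E2 → ℝ) (y : E2) : ℝ :=
  lap2 g y - (1 / 2) * (y 0 * pd g 0 y + y 1 * pd g 1 y)

def Aop (g : E2 → ℝ) (y : E2) : ℝ :=
  lap2 g y + (1 / 2) * (y 0 * pd g 0 y + y 1 * pd g 1 y) + g y

lemma pd_contDiff {g : E2 → ℝ} {n : ℕ} (hg : ContDiff ℝ (n+1 : ℕ) g) (i : Fin 2) :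
    ContDiff ℝ n (fun z => pd g i z) := by
  unfold pd
  have : ContDiff ℝ n (fderiv ℝ g) := hg.fderiv_right (by norm_cast)
  exact this.clm_apply contDiff_const

lemma pd_cont {g : E2 → ℝ} (hg : ContDiff ℝ 1 g) (i : Fin 2) :
    Continuous (fun z => pd g i z) := by
  have := pd_contDiff (n := 0) (g := g) (by simpa using hg) i
  exact this.continuous

lemma pd_c1 {g : E2 → ℝ} (hg : ContDiff ℝ 2 g) (i : Fin 2) :
    ContDiff ℝ 1 (fun z => pd g i z) := by
  have := pd_contDiff (n := 1) (g := g) (by simpa using hg) i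
  simpa using this

lemma c21 {g : E2 → ℝ} (hg : ContDiff ℝ 2 g) : ContDiff ℝ 1 g := hg.of_le (by norm_num)

lemma lap_cont {g : E2 → ℝ} (hg : ContDiff ℝ 2 g) : Continuous (lap2 g) := by
  unfold lap2
  exact continuous_finsetSum _ (fun i _ => pd_cont (pd_c1 hg i) i)

lemma Lop_cont {g : E2 → ℝ} (hg : ContDiff ℝ 2 g) : Continuous (Lop g) := by
  unfold Lop
  have h0 := pd_cont (c21 hg) 0
  have h1 := pd_cont (c21 hg) 1
  have := lap_cont hg
  fun_prop

lemma Aop_cont {g : E2 → ℝ} (hg : ContDiff ℝ 2 g) : Continuous (Aop g) := by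
  unfold Aop
  have h0 := pd_cont (c21 hg) 0
  have h1 := pd_cont (c21 hg) 1
  have := lap_cont hg
  have := hg.continuous
  fun_prop

lemma pd_supp {g : E2 → ℝ} (hg : HasCompactSupport g) (i : Fin 2) :
    HasCompactSupport (fun z => pd g i z) := by
  exact hg.fderiv_apply ℝ _

lemma lap_supp {g : E2 → ℝ} (hg : HasCompactSupport g) : HasCompactSupport (lap2 g) := by
  unfold lap2
  simp only [Fin.sum_univ_two]
  exact (pd_supp (pd_supp hg 0) 0).add (pd_supp (pd_supp hg 1) 1)

lemma Aop_supp {g : E2 → ℝ} (hg : HasCompactSupport g) : HasCompactSupport (Aop g) := by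
  unfold Aop
  refine ((lap_supp hg).add ?_).add hg
  apply HasCompactSupport.mul_left
  exact (HasCompactSupport.mul_left (pd_supp hg 0)).add (HasCompactSupport.mul_left (pd_supp hg 1))

lemma ibp1 {g ψ : E2 → ℝ} (hg : ContDiff ℝ 1 g) (hψ : ContDiff ℝ 1 ψ) (hs : HasCompactSupport ψ)
    (i : Fin 2) : ∫ z, pd g i z * ψ z = - ∫ z, g z * pd ψ i z := by
  unfold pd
  rw [integral_mul_fderiv_eq_neg_fderiv_mul_of_integrable, neg_neg]
  · exact ((pd_cont hg i).mul hψ.continuous).integrable_of_hasCompactSupport hs.mul_left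
  · exact ((hg.continuous).mul (pd_cont hψ i)).integrable_of_hasCompactSupport (pd_supp hs i).mul_left
  · exact ((hg.continuous).mul hψ.continuous).integrable_of_hasCompactSupport hs.mul_left
  · intro x _; exact (hg.differentiable (by norm_num)) x
  · intro x _; exact (hψ.differentiable (by norm_num)) x

lemma pd_coord_mul {ψ : E2 → ℝ} (hψ : ContDiff ℝ 1 ψ) (i : Fin 2) (z : E2) :
    pd (fun y => y i * ψ y) i z = ψ z + z i * pd ψ i z := by
  unfold pd
  have h1 : HasFDerivAt (fun y : E2 => y i) (ContinuousLinearMap.proj i : E2 →L[ℝ] ℝ) z :=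
    hasFDerivAt_apply i z
  have h2 := ((hψ.differentiable (by norm_num)) z).hasFDerivAt
  have h3 := (h1.mul h2).fderiv
  have h4 : (fun y : E2 => y i * ψ y) = ((fun y : E2 => y i) * ψ) := rfl
  rw [h4, h3]
  simp; ring

lemma ibp {g ψ : E2 → ℝ} (hg : ContDiff ℝ 2 g) (hψ : ContDiff ℝ 2 ψ) (hs : HasCompactSupport ψ) :
    ∫ z, Lop g z * ψ z = ∫ z, g z * Aop ψ z := by
  have hg1 := c21 hg
  have hψ1 := c21 hψ
  have a : ∀ i, ∫ z, pd (fun y => pd g i y) i z * ψ z = ∫ z, g z * pd (fun y => pd ψ i y) i z := by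
    intro i
    rw [ibp1 (pd_c1 hg i) hψ1 hs i, ibp1 hg1 (pd_c1 hψ i) (pd_supp hs i) i, neg_neg]
  have hc : ∀ i : Fin 2, ContDiff ℝ 1 (fun y : E2 => y i * ψ y) := fun i =>
    (contDiff_apply ℝ ℝ i).mul hψ1
  have b : ∀ i, ∫ z, pd g i z * (z i * ψ z) = - ∫ z, g z * (ψ z + z i * pd ψ i z) := by
    intro i
    rw [ibp1 hg1 (hc i) hs.mul_left i]
    simp_rw [pd_coord_mul hψ1]
  have I1 : ∀ i, Integrable (fun z => pd (fun y => pd g i y) i z * ψ z) := fun i =>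
    ((pd_cont (pd_c1 hg i) i).mul hψ.continuous).integrable_of_hasCompactSupport hs.mul_left
  have I2 : ∀ i : Fin 2, Integrable (fun z : E2 => pd g i z * (z i * ψ z)) := fun i =>
    ((pd_cont hg1 i).mul (hc i).continuous).integrable_of_hasCompactSupport hs.mul_left.mul_left
  have I3 : ∀ i, Integrable (fun z => g z * pd (fun y => pd ψ i y) i z) := fun i =>
    (hg.continuous.mul (pd_cont (pd_c1 hψ i) i)).integrable_of_hasCompactSupport
      (pd_supp (pd_supp hs i) i).mul_left
  have I4 : ∀ i : Fin 2, Integrable (fun z : E2 => g z * (ψ z + z i * pd ψ i z)) := fun i =>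
    (hg.continuous.mul (hψ.continuous.add ((continuous_apply i).mul (pd_cont hψ1 i)))
      ).integrable_of_hasCompactSupport (hs.add (pd_supp hs i).mul_left).mul_left
  have e1 : ∀ z, Lop g z * ψ z = (pd (fun y => pd g 0 y) 0 z * ψ z + pd (fun y => pd g 1 y) 1 z * ψ z)
      + ((-(1/2)) * (pd g 0 z * (z 0 * ψ z)) + (-(1/2)) * (pd g 1 z * (z 1 * ψ z))) := by
    intro z; unfold Lop lap2; rw [Fin.sum_univ_two]; ring
  have e2 : ∀ z, g z * Aop ψ z = (g z * pd (fun y => pd ψ 0 y) 0 z + g z * pd (fun y => pd ψ 1 y) 1 z)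
      + ((1/2) * (g z * (ψ z + z 0 * pd ψ 0 z)) + (1/2) * (g z * (ψ z + z 1 * pd ψ 1 z))) := by
    intro z; unfold Aop lap2; rw [Fin.sum_univ_two]; ring
  simp_rw [e1, e2]
  rw [integral_add, integral_add, integral_add, integral_add, integral_add, integral_add,
    integral_const_mul, integral_const_mul, integral_const_mul, integral_const_mul, a, a, b, b]
  · ring
  all_goals first
    | exact I3 _ | exact I1 _ | exact (I4 _).const_mul _ | exact (I2 _).const_mul _
    | exact (I3 _).add (I3 _) | exact (I1 _).add (I1 _)
    | exact ((I4 _).const_mul _).add ((I4 _).const_mul _)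
    | exact ((I2 _).const_mul _).add ((I2 _).const_mul _)

structure SupSol (u : ℝ → E2 → ℝ) (K s1 : ℝ) : Prop where
  nonneg : ∀ t z, 0 ≤ u t z
  le : ∀ t z, u t z ≤ K
  reg : ∀ t, ContDiff ℝ 2 (u t)
  cont : ∀ z, Continuous fun t => u t z
  eq : ∀ t, s1 ≤ t → ∀ z, ∃ d, HasDerivWithinAt (fun τ => u τ z) d (Set.Ioi t) t ∧
    Lop (u t) z + (u t z ^ 2 - u t z) ≤ d

structure Test (R : ℝ) (ψ : E2 → ℝ) : Prop where
  reg : ContDiff ℝ 2 ψ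
  supp : HasCompactSupport ψ
  sub : tsupport ψ ⊆ Metric.ball 0 R
  nonneg : ∀ z, 0 ≤ ψ z

def GG (u : ℝ → E2 → ℝ) (ψ : E2 → ℝ) (t : ℝ) : ℝ := ∫ z, u t z * ψ z
def NN (u : ℝ → E2 → ℝ) (ψ : E2 → ℝ) (t : ℝ) : ℝ :=
  ∫ z, (u t z * Aop ψ z + (u t z ^ 2 - u t z) * ψ z)

lemma GG_cont {u : ℝ → E2 → ℝ} {K s1 : ℝ} (hu : SupSol u K s1) {ψ : E2 → ℝ} (hc : Continuous ψ)
    (hs : HasCompactSupport ψ) : Continuous (GG u ψ) := by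
  unfold GG
  apply continuous_of_dominated (bound := fun z => K * |ψ z|)
  · intro t; exact ((hu.reg t).continuous.mul hc).aestronglyMeasurable
  · intro t; refine ae_of_all _ fun z => ?_
    rw [norm_mul, Real.norm_eq_abs, Real.norm_eq_abs, abs_of_nonneg (hu.nonneg t z)]
    exact mul_le_mul_of_nonneg_right (hu.le t z) (abs_nonneg _)
  · exact (hc.abs.integrable_of_hasCompactSupport (hs.comp_left (g := fun x => |x|) abs_zero)).const_mul K
  · exact ae_of_all _ fun z => (hu.cont z).mul continuous_const

lemma SupSol.K_nonneg {u : ℝ → E2 → ℝ} {K s1 : ℝ} (hu : SupSol u K s1) : 0 ≤ K :=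
  (hu.nonneg 0 0).trans (hu.le 0 0)

lemma SupSol.fbd {u : ℝ → E2 → ℝ} {K s1 : ℝ} (hu : SupSol u K s1) (t z) :
    |u t z ^ 2 - u t z| ≤ K ^ 2 + K := by
  have h1 := hu.nonneg t z
  have h2 := hu.le t z
  rw [abs_le]; constructor <;> nlinarith

lemma NN_cont {u : ℝ → E2 → ℝ} {K s1 : ℝ} (hu : SupSol u K s1) {ψ : E2 → ℝ} (hc : ContDiff ℝ 2 ψ)
    (hs : HasCompactSupport ψ) : Continuous (NN u ψ) := by
  unfold NN
  have hA := Aop_cont hc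
  have hK := hu.K_nonneg
  apply continuous_of_dominated (bound := fun z => K * |Aop ψ z| + (K ^ 2 + K) * |ψ z|)
  · intro t
    have := (hu.reg t).continuous
    have := hc.continuous
    exact Continuous.aestronglyMeasurable (by fun_prop)
  · intro t; refine ae_of_all _ fun z => ?_
    refine (norm_add_le _ _).trans (add_le_add ?_ ?_)
    · rw [norm_mul, Real.norm_eq_abs, Real.norm_eq_abs, abs_of_nonneg (hu.nonneg t z)]
      exact mul_le_mul_of_nonneg_right (hu.le t z) (abs_nonneg _)
    · rw [norm_mul, Real.norm_eq_abs, Real.norm_eq_abs]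
      exact mul_le_mul_of_nonneg_right (hu.fbd t z) (abs_nonneg _)
  · exact ((hA.abs.integrable_of_hasCompactSupport ((Aop_supp hs).comp_left (g := fun x => |x|) abs_zero)).const_mul K).add
      ((hc.continuous.abs.integrable_of_hasCompactSupport (hs.comp_left (g := fun x => |x|) abs_zero)).const_mul _)
  · exact ae_of_all _ fun z => by
      have := hu.cont z
      fun_prop

lemma NN_eq {u : ℝ → E2 → ℝ} {K s1 : ℝ} (hu : SupSol u K s1) {ψ : E2 → ℝ} (hc : ContDiff ℝ 2 ψ)
    (hs : HasCompactSupport ψ) (t : ℝ) :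
    NN u ψ t = ∫ z, (Lop (u t) z + (u t z ^ 2 - u t z)) * ψ z := by
  have hr := hu.reg t
  have c1 := hr.continuous
  have c2 := hc.continuous
  have I1 : Integrable (fun z => u t z * Aop ψ z) :=
    (c1.mul (Aop_cont hc)).integrable_of_hasCompactSupport (Aop_supp hs).mul_left
  have I2 : Integrable (fun z => (u t z ^ 2 - u t z) * ψ z) :=
    Continuous.integrable_of_hasCompactSupport (by fun_prop) hs.mul_left
  have I3 : Integrable (fun z => Lop (u t) z * ψ z) :=
    ((Lop_cont hr).mul c2).integrable_of_hasCompactSupport hs.mul_left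
  unfold NN
  simp_rw [add_mul]
  rw [integral_add I1 I2, integral_add I3 I2, ibp hr hc hs]

lemma min_test {g : E2 → ℝ} (hg : ContDiff ℝ 2 g) {x : E2} (hx : IsLocalMin g x) (i : Fin 2) :
    pd g i x = 0 ∧ 0 ≤ pd (fun z => pd g i z) i x := by
  have h0 : fderiv ℝ g x = 0 := hx.fderiv_eq_zero
  refine ⟨by simp [pd, h0], ?_⟩
  by_contra hneg
  push Not at hneg
  set e : E2 := Pi.single i 1
  have hl : ∀ r : ℝ, HasDerivAt (fun r : ℝ => x + r • e) e r := fun r => by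
    simpa using ((hasDerivAt_id r).smul_const e).const_add x
  have hd : ∀ {h : E2 → ℝ}, ContDiff ℝ 1 h → ∀ r : ℝ,
      HasDerivAt (fun r : ℝ => h (x + r • e)) (pd h i (x + r • e)) r := by
    intro h hh r
    exact ((hh.differentiable (by norm_num)) _).hasFDerivAt.comp_hasDerivAt r (hl r)
  set f : ℝ → ℝ := fun r => g (x + r • e)
  have hf1 : deriv f = fun r => pd g i (x + r • e) := by
    funext r; exact (hd (c21 hg) r).deriv
  have hf2 : deriv (deriv f) 0 = pd (fun z => pd g i z) i x := by
    rw [hf1]; have := (hd (pd_c1 hg i) 0).deriv; simpa using this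
  have hcont : Continuous (fun r : ℝ => x + r • e) := by fun_prop
  have hmax : IsLocalMax f 0 := by
    apply isLocalMax_of_deriv_deriv_neg
    · rw [hf2]; exact hneg
    · rw [hf1]; simp [pd, h0]
    · exact (hg.continuous.comp hcont).continuousAt
  have hmin : IsLocalMin f 0 := by
    have : Tendsto (fun r : ℝ => x + r • e) (𝓝 0) (𝓝 x) := by
      have := hcont.tendsto 0; simpa using this
    have h2 := this.eventually hx
    simpa [IsLocalMin, IsMinFilter, f] using h2
  have heq : f =ᶠ[𝓝 0] fun _ => f 0 := by
    filter_upwards [hmax, hmin] with r h1 h2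
    exact le_antisymm h1 h2
  have h3 : deriv f =ᶠ[𝓝 0] fun _ => 0 := by
    have := heq.deriv
    simpa using this
  have h4 := h3.deriv_eq
  rw [hf2] at h4
  simp at h4
  linarith

def mm (x : ℝ) : ℝ := max x 0 ^ 3

lemma hasDerivAt_maxpow (n : ℕ) (x : ℝ) :
    HasDerivAt (fun x : ℝ => max x 0 ^ (n + 2)) ((n + 2) * max x 0 ^ (n + 1)) x := by
  rcases lt_trichotomy x 0 with h | h | h
  · have : (fun x : ℝ => max x 0 ^ (n + 2)) =ᶠ[𝓝 x] fun _ => 0 := by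
      filter_upwards [Iio_mem_nhds h] with y hy
      rw [max_eq_right (le_of_lt hy)]; simp
    rw [max_eq_right h.le]
    simpa using (hasDerivAt_const x (0:ℝ)).congr_of_eventuallyEq this
  · subst h
    simp only [max_self]
    have : HasDerivAt (fun x : ℝ => max x 0 ^ (n + 2)) 0 0 := by
      rw [hasDerivAt_iff_isLittleO_nhds_zero]
      simp only [zero_add, max_self, smul_zero, sub_zero]
      have h1 : (fun h : ℝ => max h 0 ^ (n+2) - 0 ^ (n+2)) =O[𝓝 0] fun h : ℝ => h ^ (n+2) := by
        refine IsBigO.of_bound 1 (Eventually.of_forall fun h => ?_)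
        simp only [ne_eq, Nat.add_eq_zero_iff, OfNat.ofNat_ne_zero, and_false, not_false_eq_true, zero_pow, sub_zero, norm_pow, one_mul]
        refine pow_le_pow_left₀ (norm_nonneg _) ?_ _
        rw [Real.norm_eq_abs, Real.norm_eq_abs, abs_of_nonneg (le_max_right _ _)]
        exact max_le (le_abs_self h) (abs_nonneg h)
      refine h1.trans_isLittleO ?_
      have := isLittleO_pow_id (𝕜 := ℝ) (n := n+2) (by omega)
      simpa using this
    simpa using this
  · have : (fun x : ℝ => max x 0 ^ (n + 2)) =ᶠ[𝓝 x] fun x => x ^ (n+2) := by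
      filter_upwards [Ioi_mem_nhds h] with y hy
      rw [max_eq_left (le_of_lt hy)]
    rw [max_eq_left h.le]
    have h2 := (hasDerivAt_pow (n+2) x).congr_of_eventuallyEq this
    simpa using h2

lemma mm_deriv (x : ℝ) : HasDerivAt mm (3 * max x 0 ^ 2) x := by
  have := hasDerivAt_maxpow 1 x
  norm_num at this
  exact this

lemma mm1_deriv (x : ℝ) : HasDerivAt (fun x => 3 * max x 0 ^ 2) (6 * max x 0) x := by
  have := (hasDerivAt_maxpow 0 x).const_mul 3
  refine HasDerivAt.congr_deriv this ?_
  norm_num; ring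

lemma mm1_c1 : ContDiff ℝ 1 (fun x : ℝ => 3 * max x 0 ^ 2) := by
  rw [contDiff_one_iff_deriv]
  refine ⟨fun x => (mm1_deriv x).differentiableAt, ?_⟩
  have : deriv (fun x : ℝ => 3 * max x 0 ^ 2) = fun x => 6 * max x 0 := by
    funext x; exact (mm1_deriv x).deriv
  rw [this]; fun_prop

lemma mm_c2 : ContDiff ℝ 2 mm := by
  have : (2 : WithTop ℕ∞) = 1 + 1 := by norm_num
  rw [this, contDiff_succ_iff_deriv]
  refine ⟨fun x => (mm_deriv x).differentiableAt, by simp, ?_⟩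
  have : deriv mm = fun x => 3 * max x 0 ^ 2 := by
    funext x; exact (mm_deriv x).deriv
  rw [this]; exact mm1_c1

def qq (r : ℝ) (z : E2) : ℝ := 1 - (z 0 ^ 2 + z 1 ^ 2) / r ^ 2

lemma qq_cd (r : ℝ) {n} : ContDiff ℝ n (qq r) := by
  unfold qq
  have h : ∀ i : Fin 2, ContDiff ℝ n (fun z : E2 => z i) := fun i => contDiff_apply ℝ ℝ i
  exact contDiff_const.sub ((((h 0).pow 2).add ((h 1).pow 2)).div_const _)

lemma qq_pd (r : ℝ) (i : Fin 2) (z : E2) : pd (qq r) i z = - (2 * z i / r ^ 2) := by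
  have h : ∀ i : Fin 2, HasFDerivAt (fun z : E2 => z i) (ContinuousLinearMap.proj i : E2 →L[ℝ] ℝ) z :=
    fun i => hasFDerivAt_apply i z
  have h2 := ((((h 0).pow 2).add ((h 1).pow 2)).mul_const ((r^2)⁻¹)).const_sub 1
  have h3 : (fun x : E2 => 1 - ((fun z : E2 => z 0) ^ 2 + (fun z : E2 => z 1) ^ 2) x * ((r^2)⁻¹)) = qq r := by
    funext x; simp [qq, div_eq_mul_inv]
  unfold pd
  rw [← h3]
  erw [h2.fderiv]
  fin_cases i <;> simp <;> ring

lemma pd_comp {h : ℝ → ℝ} {h' : ℝ} {g : E2 → ℝ} {z : E2} (hg : DifferentiableAt ℝ g z)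
    (hh : HasDerivAt h h' (g z)) (i : Fin 2) : pd (fun y => h (g y)) i z = h' * pd g i z := by
  unfold pd
  have := (hh.comp_hasFDerivAt z hg.hasFDerivAt).fderiv
  have e : (fun y => h (g y)) = h ∘ g := rfl
  rw [e, this]; simp

lemma pd_mul {f g : E2 → ℝ} {z : E2} (hf : DifferentiableAt ℝ f z) (hg : DifferentiableAt ℝ g z)
    (i : Fin 2) : pd (fun y => f y * g y) i z = pd f i z * g z + f z * pd g i z := by
  unfold pd
  have := (hf.hasFDerivAt.mul hg.hasFDerivAt).fderiv
  have e : (fun y => f y * g y) = f * g := rfl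
  rw [e, this]; simp; ring

lemma pd_coord (i j : Fin 2) (z : E2) : pd (fun y => y i) j z = if i = j then 1 else 0 := by
  unfold pd
  have h : HasFDerivAt (fun z : E2 => z i) (ContinuousLinearMap.proj i : E2 →L[ℝ] ℝ) z :=
    hasFDerivAt_apply i z
  rw [h.fderiv]
  simp [Pi.single_apply]

def cut (r : ℝ) (z : E2) : ℝ := mm (qq r z)

lemma cut_c2 (r : ℝ) : ContDiff ℝ 2 (cut r) := mm_c2.comp (qq_cd r)
lemma qq_diff (r : ℝ) (z : E2) : DifferentiableAt ℝ (qq r) z :=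
  ((qq_cd (n := 1) r).differentiable (by norm_num)) z

lemma cut_pd (r : ℝ) (i : Fin 2) (z : E2) :
    pd (cut r) i z = (3 * max (qq r z) 0 ^ 2) * (- (2 * z i / r ^ 2)) := by
  unfold cut
  rw [pd_comp (qq_diff r z) (mm_deriv _), qq_pd]

lemma cut_pd2 (r : ℝ) (i : Fin 2) (z : E2) :
    pd (fun y => pd (cut r) i y) i z = (6 * max (qq r z) 0) * (2 * z i / r ^ 2) ^ 2
      - (3 * max (qq r z) 0 ^ 2) * (2 / r ^ 2) := by
  have e : (fun y => pd (cut r) i y) =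
      fun y => (fun y => 3 * max (qq r y) 0 ^ 2) y * (fun y : E2 => (fun x : ℝ => -(2 * x / r^2)) (y i)) y := by
    funext y; exact cut_pd r i y
  have d1 : DifferentiableAt ℝ (fun y : E2 => y i) z := (hasFDerivAt_apply i z).differentiableAt
  have d2 : HasDerivAt (fun x : ℝ => -(2 * x / r^2)) (-(2 / r^2)) (z i) := by
    have := (((hasDerivAt_id (z i)).const_mul 2).div_const (r^2)).neg
    refine HasDerivAt.congr_deriv this ?_
    ring
  rw [e, pd_mul, pd_comp (h := fun x => 3 * max x 0 ^ 2) (qq_diff r z) (mm1_deriv _), qq_pd,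
    pd_comp (h := (fun x : ℝ => -(2 * x / r^2))) d1 d2, pd_coord]
  · simp; ring
  · exact ((mm1_deriv _).comp_hasFDerivAt z (qq_diff r z).hasFDerivAt).differentiableAt
  · exact (d2.comp_hasFDerivAt z d1.hasFDerivAt).differentiableAt

lemma cut_nonneg (r : ℝ) (z : E2) : 0 ≤ cut r z := by unfold cut mm; positivity

lemma cut_le_one (r : ℝ) (z : E2) : cut r z ≤ 1 := by
  unfold cut mm
  refine pow_le_one₀ (le_max_right _ _) (max_le ?_ zero_le_one)
  unfold qq; have : 0 ≤ (z 0 ^ 2 + z 1 ^ 2) / r ^ 2 := by positivity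
  linarith

lemma cut_zero {r : ℝ} (hr : 0 < r) {z : E2} (hz : r ≤ ‖z‖) : cut r z = 0 := by
  unfold cut mm
  have : qq r z ≤ 0 := by
    have h1 : ∃ i : Fin 2, r ≤ |z i| := by
      by_contra h; push Not at h
      have := (pi_norm_lt_iff (x := z) hr).2 (fun i => by simpa using h i)
      linarith
    obtain ⟨i, hi⟩ := h1
    have h2 : r^2 ≤ (z i)^2 := by rw [← sq_abs (z i)]; gcongr
    have h3 : (z i)^2 ≤ z 0 ^ 2 + z 1 ^ 2 := by fin_cases i <;> simp <;> positivity
    unfold qq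
    rw [sub_nonpos, le_div_iff₀ (by positivity)]; linarith
  rw [max_eq_right this]; norm_num

lemma cut_supp_sub {r : ℝ} (hr : 0 < r) : tsupport (cut r) ⊆ Metric.closedBall 0 r := by
  apply closure_minimal _ Metric.isClosed_closedBall
  intro z hz
  by_contra h
  apply hz
  apply cut_zero hr
  simp at h; exact h.le

lemma cut_supp {r : ℝ} (hr : 0 < r) : HasCompactSupport (cut r) :=
  HasCompactSupport.of_support_subset_isCompact (isCompact_closedBall 0 r)
    ((subset_tsupport _).trans (cut_supp_sub hr))

lemma cut_int_pos {r : ℝ} (hr : 0 < r) : 0 < ∫ z, cut r z := by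
  apply Continuous.integral_pos_of_hasCompactSupport_nonneg_nonzero (cut_c2 r).continuous
    (cut_supp hr) (cut_nonneg r) (x := 0)
  unfold cut mm qq; simp

/-- normalized bump -/
def eta (r : ℝ) (z : E2) : ℝ := cut r z * (∫ z, cut r z)⁻¹

structure Moll (r : ℝ) (η : E2 → ℝ) : Prop where
  reg : ContDiff ℝ 2 η
  supp : HasCompactSupport η
  zero : ∀ z, r ≤ ‖z‖ → η z = 0
  nonneg : ∀ z, 0 ≤ η z
  int : ∫ z, η z = 1
  dec : ∀ z : E2, z 0 * pd η 0 z + z 1 * pd η 1 z ≤ 0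

lemma exists_moll {r : ℝ} (hr : 0 < r) : ∃ η, Moll r η := by
  set c := (∫ z, cut r z)⁻¹ with hc
  have hcp : 0 < c := inv_pos.2 (cut_int_pos hr)
  refine ⟨fun z => cut r z * c, ?_, ?_, ?_, ?_, ?_, ?_⟩
  · exact (cut_c2 r).mul contDiff_const
  · exact (cut_supp hr).mul_right
  · intro z hz; simp [cut_zero hr hz]
  · intro z; exact mul_nonneg (cut_nonneg r z) hcp.le
  · rw [integral_mul_const, hc, mul_inv_cancel₀ (cut_int_pos hr).ne']
  · intro z
    have hp : ∀ i, pd (fun z => cut r z * c) i z = pd (cut r) i z * c := by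
      intro i
      have := pd_comp (h := fun x => x * c) (h' := c) (g := cut r) (z := z)
        (((cut_c2 r).differentiable (by norm_num)) z)
        (by simpa using (hasDerivAt_id (cut r z)).mul_const c) i
      rw [this]; ring
    rw [hp, hp, cut_pd, cut_pd]
    have : z 0 * (3 * max (qq r z) 0 ^ 2 * -(2 * z 0 / r ^ 2) * c) +
      z 1 * (3 * max (qq r z) 0 ^ 2 * -(2 * z 1 / r ^ 2) * c) =
      - (6 * max (qq r z) 0 ^ 2 * c * ((z 0)^2 + (z 1)^2) / r^2) := by ring
    rw [this, neg_nonpos]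
    positivity

lemma Moll.dec_int {r : ℝ} {η : E2 → ℝ} (h : Moll r η) :
    ∫ z : E2, (z 0 * pd η 0 z + z 1 * pd η 1 z) = -2 := by
  have hc1 := c21 h.reg
  have a : ∀ i : Fin 2, ∫ z : E2, z i * pd η i z = -1 := by
    intro i
    have := ibp1 (g := fun y : E2 => y i) (contDiff_apply ℝ ℝ i) hc1 h.supp i
    simp only [pd_coord, if_true, one_mul, h.int] at this
    linarith
  have I : ∀ i : Fin 2, Integrable (fun z : E2 => z i * pd η i z) := fun i =>
    ((continuous_apply i).mul (pd_cont hc1 i)).integrable_of_hasCompactSupport (pd_supp h.supp i).mul_left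
  rw [integral_add (I 0) (I 1), a, a]; norm_num

lemma conv_fd {g θ : E2 → ℝ} (hg : Continuous g) (hθ : ContDiff ℝ 1 θ) (hs : HasCompactSupport θ)
    (i : Fin 2) (x : E2) :
    pd (fun x => ∫ z, g z * θ (x - z)) i x = ∫ z, g z * pd θ i (x - z) := by
  have h := hs.hasFDerivAt_convolution_right (ContinuousLinearMap.mul ℝ ℝ)
    (hg.locallyIntegrable (μ := volume)) hθ x
  have h2 := convolution_precompR_apply (ContinuousLinearMap.mul ℝ ℝ)
    (hg.locallyIntegrable (μ := volume)) (hs.fderiv ℝ) (hθ.continuous_fderiv (by norm_num)) x (Pi.single i 1)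
  unfold pd
  erw [h.fderiv]
  rw [h2]
  rfl

lemma conv_c2 {g θ : E2 → ℝ} (hg : Continuous g) (hθ : ContDiff ℝ 2 θ) (hs : HasCompactSupport θ) :
    ContDiff ℝ 2 (fun x => ∫ z, g z * θ (x - z)) :=
  hs.contDiff_convolution_right (ContinuousLinearMap.mul ℝ ℝ)
    (hg.locallyIntegrable (μ := volume)) hθ

lemma pd_refl {θ : E2 → ℝ} (hθ : ContDiff ℝ 1 θ) (x : E2) (i : Fin 2) (z : E2) :
    pd (fun z => θ (x - z)) i z = - pd θ i (x - z) := by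
  unfold pd
  have h1 : HasFDerivAt (fun z : E2 => x - z) (-(ContinuousLinearMap.id ℝ E2)) z :=
    (hasFDerivAt_id z).const_sub x
  have := ((((hθ.differentiable (by norm_num)) (x - z)).hasFDerivAt).comp z h1).fderiv
  have e : (fun z => θ (x - z)) = θ ∘ (fun z => x - z) := rfl
  rw [e, this]; simp

lemma pd2_refl {θ : E2 → ℝ} (hθ : ContDiff ℝ 2 θ) (x : E2) (i : Fin 2) (z : E2) :
    pd (fun y => pd (fun z => θ (x - z)) i y) i z = pd (fun y => pd θ i y) i (x - z) := by
  have e : (fun y => pd (fun z => θ (x - z)) i y) = fun y => (-1) * pd θ i (x - y) := by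
    funext y; rw [pd_refl (c21 hθ)]; ring
  rw [e]
  have c := pd_c1 hθ i
  have c' : ContDiff ℝ 1 (fun y => pd θ i (x - y)) := c.comp (contDiff_const.sub contDiff_id)
  rw [pd_comp (h := fun t => (-1) * t) (h' := -1) (g := fun y => pd θ i (x - y))
    ((c'.differentiable (by norm_num)) z) (by simpa using (hasDerivAt_id (pd θ i (x - z))).const_mul (-1)),
    pd_refl c]
  ring

lemma refl_supp {θ : E2 → ℝ} (hs : HasCompactSupport θ) (x : E2) :
    HasCompactSupport (fun z => θ (x - z)) :=
  hs.comp_homeomorph (Homeomorph.subLeft x)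

lemma NN_lower {u : ℝ → E2 → ℝ} {K s1 : ℝ} (hu : SupSol u K s1) {r : ℝ} {η : E2 → ℝ}
    (h : Moll r η) (x : E2) (t : ℝ) :
    lap2 (fun x => ∫ z, u t z * η (x - z)) x
      - (1 / 2) * (x 0 * pd (fun x => ∫ z, u t z * η (x - z)) 0 x
        + x 1 * pd (fun x => ∫ z, u t z * η (x - z)) 1 x) - K - 1
      ≤ NN u (fun z => η (x - z)) t := by
  have hg := (hu.reg t).continuous
  have hr := h.reg
  have h1 := c21 hr
  have e1 : ∀ i x, pd (fun x => ∫ z, u t z * η (x - z)) i x = ∫ z, u t z * pd η i (x - z) :=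
    fun i x => conv_fd hg h1 h.supp i x
  have e2 : ∀ i, pd (fun y => pd (fun x => ∫ z, u t z * η (x - z)) i y) i x
      = ∫ z, u t z * pd (fun y => pd η i y) i (x - z) := by
    intro i
    simp_rw [e1]
    exact conv_fd hg (pd_c1 hr i) (pd_supp h.supp i) i x
  have hcx : Continuous (fun z : E2 => x - z) := by fun_prop
  have I1 : ∀ i, Integrable (fun z => u t z * pd η i (x - z)) := fun i =>
    (hg.mul ((pd_cont h1 i).comp hcx)).integrable_of_hasCompactSupport
      (refl_supp (pd_supp h.supp i) x).mul_left
  have I2 : ∀ i, Integrable (fun z => u t z * pd (fun y => pd η i y) i (x - z)) := fun i =>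
    (hg.mul ((pd_cont (pd_c1 hr i) i).comp hcx)).integrable_of_hasCompactSupport
      (refl_supp (pd_supp (pd_supp h.supp i) i) x).mul_left
  set D : E2 → ℝ := fun z => z 0 * pd η 0 z + z 1 * pd η 1 z with hD
  have cD : Continuous D := by
    have := pd_cont h1 0
    have := pd_cont h1 1
    fun_prop
  have sD : HasCompactSupport D := (pd_supp h.supp 0).mul_left.add (pd_supp h.supp 1).mul_left
  have I3 : Integrable (fun z => D (x - z)) :=
    (cD.comp hcx).integrable_of_hasCompactSupport (refl_supp sD x)
  have I4 : Integrable (fun z => η (x - z)) :=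
    (hr.continuous.comp hcx).integrable_of_hasCompactSupport (refl_supp h.supp x)
  have iD : ∫ z, D (x - z) = -2 := by
    rw [integral_sub_left_eq_self D volume x]; exact h.dec_int
  have iη : ∫ z, η (x - z) = 1 := by
    rw [integral_sub_left_eq_self η volume x]; exact h.int
  have key : ∫ z, ((u t z * pd (fun y => pd η 0 y) 0 (x - z) + u t z * pd (fun y => pd η 1 y) 1 (x - z))
      + (-(1/2) * x 0 * (u t z * pd η 0 (x - z)) + -(1/2) * x 1 * (u t z * pd η 1 (x - z)))
      + ((K/2) * D (x - z) - η (x - z))) ≤ NN u (fun z => η (x - z)) t := by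
    unfold NN
    apply integral_mono
    · exact (((I2 0).add (I2 1)).add (((I1 0).const_mul _).add ((I1 1).const_mul _))).add
        ((I3.const_mul _).sub I4)
    · have c : ContDiff ℝ 2 (fun z => η (x - z)) := hr.comp (contDiff_const.sub contDiff_id)
      have hA := Aop_cont c
      have := c.continuous
      refine Continuous.integrable_of_hasCompactSupport (by fun_prop) ?_
      exact (Aop_supp (refl_supp h.supp x)).mul_left.add (refl_supp h.supp x).mul_left
    · intro z
      have hA : Aop (fun z => η (x - z)) z = pd (fun y => pd η 0 y) 0 (x - z) +
          pd (fun y => pd η 1 y) 1 (x - z) - (1/2) * (z 0 * pd η 0 (x - z) + z 1 * pd η 1 (x - z))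
          + η (x - z) := by
        unfold Aop lap2
        rw [Fin.sum_univ_two, pd2_refl hr, pd2_refl hr, pd_refl h1, pd_refl h1]; ring
      have hd := h.dec (x - z)
      have hn := h.nonneg (x - z)
      have u0 := hu.nonneg t z
      have uK := hu.le t z
      have hDe : D (x - z) = (x 0 - z 0) * pd η 0 (x - z) + (x 1 - z 1) * pd η 1 (x - z) := rfl
      have hd' : D (x - z) ≤ 0 := hd
      show _ ≤ u t z * Aop (fun z => η (x - z)) z + (u t z ^ 2 - u t z) * η (x - z)
      rw [hA]
      have q1 : 0 ≤ (K - u t z) * (- D (x - z)) := mul_nonneg (by linarith) (by linarith)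
      have q2 : 0 ≤ (u t z ^ 2 + 1) * η (x - z) := by positivity
      beta_reduce
      rw [hDe] at q1 ⊢
      nlinarith
  have e3 := key
  rw [integral_add, integral_add, integral_add, integral_add, integral_sub, integral_const_mul,
    integral_const_mul, integral_const_mul, iD, iη] at e3
  · unfold lap2
    rw [Fin.sum_univ_two, e2, e2, e1, e1]
    linarith
  all_goals first
    | exact I1 _ | exact I2 _ | exact I4 | exact I3.const_mul _ | exact (I1 _).const_mul _
    | exact (I2 _).add (I2 _) | exact ((I1 _).const_mul _).add ((I1 _).const_mul _)
    | exact ((I2 _).add (I2 _)).add (((I1 _).const_mul _).add ((I1 _).const_mul _))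
    | exact (I3.const_mul _).sub I4

lemma U_cont {u : ℝ → E2 → ℝ} {K s1 : ℝ} (hu : SupSol u K s1) {r : ℝ} {η : E2 → ℝ}
    (h : Moll r η) : Continuous (fun p : ℝ × E2 => ∫ z, u p.1 z * η (p.2 - z)) := by
  rw [continuous_iff_continuousAt]
  rintro ⟨t0, x0⟩
  obtain ⟨B, hB⟩ := h.supp.exists_bound_of_continuous h.reg.continuous
  have hB0 : 0 ≤ B := (norm_nonneg _).trans (hB 0)
  have hcx : ∀ x : E2, Continuous (fun z : E2 => x - z) := fun x => by fun_prop
  apply continuousAt_of_dominated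
    (bound := (Metric.closedBall x0 (1 + r)).indicator (fun _ => K * B))
  · exact Eventually.of_forall fun p =>
      ((hu.reg p.1).continuous.mul (h.reg.continuous.comp (hcx p.2))).aestronglyMeasurable
  · have : ∀ᶠ p : ℝ × E2 in 𝓝 (t0, x0), p.2 ∈ Metric.ball x0 1 :=
      continuous_snd.continuousAt.eventually (Metric.ball_mem_nhds x0 one_pos)
    filter_upwards [this] with p hp
    refine ae_of_all _ fun z => ?_
    by_cases hz : z ∈ Metric.closedBall x0 (1 + r)
    · rw [Set.indicator_of_mem hz, norm_mul, Real.norm_eq_abs, abs_of_nonneg (hu.nonneg _ _)]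
      exact mul_le_mul (hu.le _ _) (hB _) (norm_nonneg _) hu.K_nonneg
    · rw [Set.indicator_of_notMem hz, h.zero, mul_zero, norm_zero]
      simp only [Metric.mem_closedBall, not_le, Metric.mem_ball] at hz hp
      rw [← dist_eq_norm]
      have := dist_triangle z p.2 x0
      rw [dist_comm z p.2] at this
      linarith
  · rw [integrable_indicator_iff Metric.isClosed_closedBall.measurableSet]
    exact integrableOn_const (isCompact_closedBall x0 (1+r)).measure_lt_top.ne
  · refine ae_of_all _ fun z => ?_
    have h1 := hu.cont z
    have h2 := h.reg.continuous
    have : Continuous fun p : ℝ × E2 => u p.1 z * η (p.2 - z) :=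
      (h1.comp continuous_fst).mul (h2.comp (by fun_prop))
    exact this.continuousAt

def Quad (M R : ℝ) (g : E2 → ℝ) : Prop :=
  ∀ x ∈ Metric.closedBall (0 : E2) R, ∃ p : E2, p ∈ Metric.closedBall (0 : E2) M ∧
    ∀ z ∈ Metric.closedBall (0 : E2) R,
      g x + (p 0 * (z 0 - x 0) + p 1 * (z 1 - x 1)) - M * ((z 0 - x 0) ^ 2 + (z 1 - x 1) ^ 2) ≤ g z

def quadf (c L : ℝ) (p x0 : E2) (x : E2) : ℝ :=
  c + (p 0 * (x 0 - x0 0) + p 1 * (x 1 - x0 1)) - L * ((x 0 - x0 0) ^ 2 + (x 1 - x0 1) ^ 2)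

lemma quadf_cd (c L : ℝ) (p x0 : E2) {n} : ContDiff ℝ n (quadf c L p x0) := by
  unfold quadf
  have h : ∀ i : Fin 2, ContDiff ℝ n (fun z : E2 => z i) := fun i => contDiff_apply ℝ ℝ i
  have h0 := h 0
  have h1 := h 1
  fun_prop

lemma quadf_pd (c L : ℝ) (p x0 : E2) (i : Fin 2) (x : E2) :
    pd (quadf c L p x0) i x = p i - 2 * L * (x i - x0 i) := by
  have h : ∀ i : Fin 2, HasFDerivAt (fun z : E2 => z i - x0 i) (ContinuousLinearMap.proj i : E2 →L[ℝ] ℝ) x :=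
    fun i => (hasFDerivAt_apply i x).sub_const _
  have h2 := ((((h 0).const_mul (p 0)).add ((h 1).const_mul (p 1))).const_add c).sub
    ((((h 0).pow 2).add ((h 1).pow 2)).const_mul L)
  unfold pd
  have e : HasFDerivAt (quadf c L p x0) _ x := h2
  rw [e.fderiv]
  fin_cases i <;> simp <;> ring

lemma quadf_pd2 (c L : ℝ) (p x0 : E2) (i : Fin 2) (x : E2) :
    pd (fun y => pd (quadf c L p x0) i y) i x = - 2 * L := by
  simp_rw [quadf_pd]
  have h : HasFDerivAt (fun z : E2 => p i - 2 * L * (z i - x0 i)) _ x :=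
    (((hasFDerivAt_apply (𝕜 := ℝ) i x).sub_const (x0 i)).const_mul (2 * L)).const_sub (p i)
  unfold pd
  rw [h.fderiv]
  simp

lemma pd_sub {f g : E2 → ℝ} {z : E2} (hf : DifferentiableAt ℝ f z) (hg : DifferentiableAt ℝ g z)
    (i : Fin 2) : pd (fun y => f y - g y) i z = pd f i z - pd g i z := by
  unfold pd
  have := (hf.hasFDerivAt.sub hg.hasFDerivAt).fderiv
  have e : (fun y => f y - g y) = f - g := rfl
  rw [e, this]; simp

/-- comparison of derivatives at a local minimum of a difference with a quadratic -/
lemma min_quad {g : E2 → ℝ} (hg : ContDiff ℝ 2 g) {c L : ℝ} {p x0 x : E2}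
    (hx : IsLocalMin (fun y => g y - quadf c L p x0 y) x) :
    (∀ i, pd g i x = p i - 2 * L * (x i - x0 i)) ∧ - 4 * L ≤ lap2 g x := by
  have hq := quadf_cd c L p x0 (n := 2)
  have hm := min_test (hg.sub hq) hx
  have d1 : ∀ y, DifferentiableAt ℝ g y := hg.differentiable (by norm_num)
  have d2 : ∀ y, DifferentiableAt ℝ (quadf c L p x0) y := hq.differentiable (by norm_num)
  have e : ∀ i y, pd (fun y => g y - quadf c L p x0 y) i y = pd g i y - pd (quadf c L p x0) i y :=
    fun i y => pd_sub (d1 y) (d2 y) i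
  refine ⟨fun i => ?_, ?_⟩
  · have := (hm i).1
    rw [e, quadf_pd] at this; linarith
  · have k : ∀ i, - 2 * L ≤ pd (fun y => pd g i y) i x := by
      intro i
      have := (hm i).2
      simp_rw [e] at this
      rw [pd_sub (((pd_c1 hg i).differentiable (by norm_num)) x)
        (((pd_c1 hq i).differentiable (by norm_num)) x), quadf_pd2] at this
      linarith
    unfold lap2; rw [Fin.sum_univ_two]
    linarith [k 0, k 1]

def GoodOn (u : ℝ → E2 → ℝ) (R a b : ℝ) : Prop :=
  ∀ ψ, Test R ψ → ∀ t t', a ≤ t → t ≤ t' → t' ≤ b →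
    ∫ τ in t..t', NN u ψ τ ≤ GG u ψ t' - GG u ψ t

lemma abs_coord_le (z : E2) (i : Fin 2) : |z i| ≤ ‖z‖ := by
  simpa using norm_le_pi_norm z i

lemma gap_eps {u : ℝ → E2 → ℝ} {K s1 : ℝ} (hu : SupSol u K s1) {R M δ a b : ℝ} (hδ : 0 < δ)
    (hM : 0 ≤ M) (hgood : GoodOn u R a b) (hq : Quad M R (u a)) {x0 : E2} (hx0 : ‖x0‖ + 2 * δ ≤ R)
    {r : ℝ} {η : E2 → ℝ} (hr : 0 < r) (hrδ : r < δ) (h : Moll r η)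
    {L C : ℝ} (hL : L = M + (K + 2 * M * δ) / δ ^ 2) (hC : C = 4 * L + R * (M + 2 * L * δ) + K + 2)
    {t : ℝ} (hat : a ≤ t) (htb : t ≤ b) :
    u a x0 - C * (t - a) - (2 * M + 6 * M * δ) * r ≤ ∫ z, u t z * η (x0 - z) := by
  have hK := hu.K_nonneg
  have hR : 0 ≤ R := by have := norm_nonneg x0; linarith
  have hL0 : 0 ≤ (K + 2 * M * δ) / δ ^ 2 := by positivity
  have hLM : M ≤ L := by linarith
  obtain ⟨p, hpM, hp⟩ := hq x0 (by simp; linarith)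
  have hp0 : ∀ i, |p i| ≤ M := fun i => (abs_coord_le p i).trans (by simpa using hpM)
  set κ := (2 * M + 6 * M * δ) * r with hκ
  have hκ0 : 0 ≤ κ := by positivity
  set c := u a x0 with hc
  set U : ℝ → E2 → ℝ := fun t x => ∫ z, u t z * η (x - z) with hU
  have hUc : Continuous (fun q : ℝ × E2 => U q.1 q.2) := U_cont hu h
  set V : ℝ × E2 → ℝ := fun q => U q.1 q.2 - quadf c L p x0 q.2 + C * (q.1 - a) + κ with hV
  have hVc : Continuous V := by
    have := (quadf_cd c L p x0 (n := 0)).continuous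
    have h2 : Continuous (fun q : ℝ × E2 => quadf c L p x0 q.2) := this.comp continuous_snd
    fun_prop
  have hUpos : ∀ t x, 0 ≤ U t x := fun t x =>
    integral_nonneg fun z => mul_nonneg (hu.nonneg t z) (h.nonneg _)
  have hcK : c ≤ K := hu.le a x0
  -- lateral
  have hLp : 0 ≤ L := hM.trans hLM
  have hC0 : 0 ≤ C := by rw [hC]; positivity
  have hlat : ∀ t x, a ≤ t → ‖x - x0‖ = δ → 0 ≤ V (t, x) := by
    intro t x ht hx
    have h1 : ∀ i, |x i - x0 i| ≤ δ := fun i => by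
      have := abs_coord_le (x - x0) i
      rw [hx] at this; simpa using this
    have h2 : δ ^ 2 ≤ (x 0 - x0 0) ^ 2 + (x 1 - x0 1) ^ 2 := by
      by_contra hcon
      push Not at hcon
      have : ‖x - x0‖ < δ := by
        rw [pi_norm_lt_iff hδ]
        intro i
        have : (x i - x0 i)^2 < δ^2 := by
          refine lt_of_le_of_lt ?_ hcon
          fin_cases i <;> simp <;> positivity
        simpa using abs_lt_of_sq_lt_sq this hδ.le
      linarith
    have h3 : ∀ i, p i * (x i - x0 i) ≤ M * δ := fun i => by
      refine (le_abs_self _).trans ?_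
      rw [abs_mul]
      exact mul_le_mul (hp0 i) (h1 i) (abs_nonneg _) hM
    have h4 : K + 2 * M * δ ≤ L * ((x 0 - x0 0) ^ 2 + (x 1 - x0 1) ^ 2) := by
      have : K + 2 * M * δ = ((K + 2 * M * δ) / δ ^ 2) * δ ^ 2 := by field_simp
      rw [this]
      apply mul_le_mul _ h2 (by positivity) (by linarith)
      linarith
    have h5 := hUpos t x
    have h6 : 0 ≤ C * (t - a) := mul_nonneg hC0 (by linarith)
    have h30 := h3 0
    have h31 := h3 1
    simp only [hV, quadf]
    linarith
  -- initial
  have hinit : ∀ x, ‖x - x0‖ ≤ δ → 0 ≤ V (a, x) := by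
    intro x hx
    have hcx : Continuous (fun z : E2 => x - z) := by fun_prop
    have iη : ∫ z, η (x - z) = 1 := by
      rw [integral_sub_left_eq_self η volume x]; exact h.int
    have I4 : Integrable (fun z => η (x - z)) :=
      (h.reg.continuous.comp hcx).integrable_of_hasCompactSupport (refl_supp h.supp x)
    have : ∫ z, (quadf c M p x0 x - κ) * η (x - z) ≤ U a x := by
      apply integral_mono
      · exact I4.const_mul _
      · exact ((hu.reg a).continuous.mul (h.reg.continuous.comp hcx)).integrable_of_hasCompactSupport
          (refl_supp h.supp x).mul_left
      · intro z
        by_cases hz : r ≤ ‖x - z‖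
        · simp [h.zero _ hz]
        · push Not at hz
          apply mul_le_mul_of_nonneg_right _ (h.nonneg _)
          have hzR : z ∈ Metric.closedBall (0 : E2) R := by
            simp only [Metric.mem_closedBall, dist_zero_right]
            have e : z = x0 + (x - x0) - (x - z) := by abel
            rw [e]
            refine (norm_sub_le _ _).trans ((add_le_add_left (norm_add_le _ _) _).trans ?_)
            linarith
          refine le_trans ?_ (hp z hzR)
          have a1 : ∀ i, |x i - z i| ≤ r := fun i => by
            have := abs_coord_le (x - z) i
            exact (by simpa using this : |x i - z i| ≤ ‖x - z‖).trans hz.le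
          have a2 : ∀ i, |x i - x0 i| ≤ δ := fun i => by
            have := abs_coord_le (x - x0) i
            exact (by simpa using this : |x i - x0 i| ≤ ‖x - x0‖).trans hx
          have a3 : ∀ i, p i * (x i - z i) ≤ M * r := fun i => by
            refine (le_abs_self _).trans ?_
            rw [abs_mul]
            exact mul_le_mul (hp0 i) (a1 i) (abs_nonneg _) hM
          have a4 : ∀ i, (z i - x0 i)^2 - (x i - x0 i)^2 ≤ 3 * δ * r := fun i => by
            have e : (z i - x0 i)^2 - (x i - x0 i)^2 = (z i - x i) * (z i - x i + 2 * (x i - x0 i)) := by ring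
            rw [e]
            refine (le_abs_self _).trans ?_
            rw [abs_mul]
            have b1 : |z i - x i| ≤ r := by rw [abs_sub_comm]; exact a1 i
            have b2 : |z i - x i + 2 * (x i - x0 i)| ≤ 3 * δ := by
              refine (abs_add_le _ _).trans ?_
              rw [abs_mul, abs_two]
              linarith [a2 i]
            calc _ ≤ r * (3 * δ) := mul_le_mul b1 b2 (abs_nonneg _) hr.le
              _ = _ := by ring
          have a5 : M * (((z 0 - x0 0)^2 - (x 0 - x0 0)^2) + ((z 1 - x0 1)^2 - (x 1 - x0 1)^2))
              ≤ M * (6 * δ * r) := mul_le_mul_of_nonneg_left (by linarith [a4 0, a4 1]) hM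
          have a30 := a3 0
          have a31 := a3 1
          simp only [quadf, hκ]
          linarith
    rw [integral_const_mul, iη, mul_one] at this
    have q : quadf c L p x0 x ≤ quadf c M p x0 x := by
      unfold quadf
      have : M * ((x 0 - x0 0) ^ 2 + (x 1 - x0 1) ^ 2) ≤ L * ((x 0 - x0 0) ^ 2 + (x 1 - x0 1) ^ 2) :=
        mul_le_mul_of_nonneg_right hLM (by positivity)
      linarith
    simp only [hV, sub_self, mul_zero]
    linarith
  -- minimum
  have hcomp : IsCompact (Set.Icc a b ×ˢ Metric.closedBall x0 δ) :=
    isCompact_Icc.prod (isCompact_closedBall x0 δ)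
  obtain ⟨⟨t0, x'⟩, ⟨ht0, hx'⟩, hmin⟩ := hcomp.exists_isMinOn
    ⟨(a, x0), ⟨⟨le_rfl, hat.trans htb⟩, Metric.mem_closedBall_self hδ.le⟩⟩ hVc.continuousOn
  simp only [Metric.mem_closedBall, dist_eq_norm] at hx'
  simp only at ht0
  have hmin' : ∀ s x, a ≤ s → s ≤ b → ‖x - x0‖ ≤ δ → V (t0, x') ≤ V (s, x) := fun s x h1 h2 h3 =>
    hmin (show (s, x) ∈ _ from ⟨⟨h1, h2⟩, by simpa [dist_eq_norm] using h3⟩)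
  suffices hVpos : 0 ≤ V (t0, x') by
    have := hVpos.trans (hmin' t x0 hat htb (by simp [hδ.le]))
    simp only [hV, quadf] at this
    simp at this
    show _ ≤ U t x0
    linarith
  by_contra hneg
  push Not at hneg
  have hta : a < t0 := by
    rcases ht0.1.eq_or_lt with h1 | h1
    · rw [← h1] at hneg; linarith [hinit x' hx']
    · exact h1
  have hxlt : ‖x' - x0‖ < δ := by
    rcases hx'.eq_or_lt with h1 | h1
    · linarith [hlat t0 x' ht0.1 h1]
    · exact h1
  have hUc2 : ContDiff ℝ 2 (U t0) := conv_c2 (hu.reg t0).continuous h.reg h.supp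
  have hloc : IsLocalMin (fun y => U t0 y - quadf c L p x0 y) x' := by
    have : ∀ᶠ y in 𝓝 x', ‖y - x0‖ < δ := by
      have : Continuous fun y : E2 => ‖y - x0‖ := by fun_prop
      exact this.continuousAt.eventually (Iio_mem_nhds hxlt)
    filter_upwards [this] with y hy
    have := hmin' t0 y ht0.1 ht0.2 hy.le
    simp only [hV] at this
    linarith
  obtain ⟨g1, g2⟩ := min_quad hUc2 hloc
  have hN := NN_lower hu h x' t0
  have hx'R : ‖x'‖ ≤ R - δ := by
    have e : x' = x0 + (x' - x0) := by abel
    rw [e]; refine (norm_add_le _ _).trans ?_; linarith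
  have g3 : ∀ i, x' i * pd (U t0) i x' ≤ R * (M + 2 * L * δ) := by
    intro i
    rw [g1]
    refine (le_abs_self _).trans ?_
    rw [abs_mul]
    refine mul_le_mul ((abs_coord_le x' i).trans (by linarith)) ?_ (abs_nonneg _) hR
    refine (abs_sub _ _).trans (add_le_add (hp0 i) ?_)
    rw [abs_mul, abs_of_nonneg (by linarith : (0:ℝ) ≤ 2 * L)]
    refine mul_le_mul_of_nonneg_left ?_ (by linarith)
    have := abs_coord_le (x' - x0) i
    exact (by simpa using this : |x' i - x0 i| ≤ ‖x' - x0‖).trans hx'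
  have hN2 : - C + 1 ≤ NN u (fun z => η (x' - z)) t0 := by
    refine le_trans ?_ hN
    have g30 := g3 0
    have g31 := g3 1
    rw [hC]
    change _ ≤ lap2 (U t0) x' - 1 / 2 * (x' 0 * pd (U t0) 0 x' + x' 1 * pd (U t0) 1 x') - K - 1
    linarith
  have hψc : ContDiff ℝ 2 (fun z => η (x' - z)) := h.reg.comp (contDiff_const.sub contDiff_id)
  have hψs := refl_supp h.supp x'
  have hT : Test R (fun z => η (x' - z)) := by
    refine ⟨hψc, hψs, ?_, fun z => h.nonneg _⟩
    have : tsupport (fun z => η (x' - z)) ⊆ Metric.closedBall x' r := by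
      apply closure_minimal _ Metric.isClosed_closedBall
      intro z hz
      by_contra hcon
      apply hz
      apply h.zero
      simp only [Metric.mem_closedBall, not_le, dist_eq_norm] at hcon
      rw [norm_sub_rev]; exact hcon.le
    refine this.trans fun z hz => ?_
    simp only [Metric.mem_closedBall, Metric.mem_ball, dist_eq_norm, sub_zero] at hz ⊢
    have e : z = x' + (z - x') := by abel
    rw [e]; refine (norm_add_le _ _).trans_lt ?_; linarith
  have hNc := NN_cont hu hψc hψs
  have hev : ∀ᶠ s in 𝓝 t0, -C + 1/2 < NN u (fun z => η (x' - z)) s :=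
    hNc.continuousAt.eventually (Ioi_mem_nhds (by linarith))
  obtain ⟨ε, hε, hball⟩ := Metric.eventually_nhds_iff.1 hev
  set s := max a (t0 - ε / 2) with hs
  have hs1 : a ≤ s := le_max_left _ _
  have hs2 : s < t0 := max_lt hta (by linarith)
  have hs3 : t0 - ε / 2 ≤ s := le_max_right _ _
  have hg := hgood _ hT s t0 hs1 hs2.le ht0.2
  have hlow : (-C + 1/2) * (t0 - s) ≤ ∫ τ in s..t0, NN u (fun z => η (x' - z)) τ := by
    have : ∫ τ in s..t0, (-C + 1/2) ≤ ∫ τ in s..t0, NN u (fun z => η (x' - z)) τ := by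
      apply intervalIntegral.integral_mono_on hs2.le (by simp) (hNc.intervalIntegrable _ _)
      intro τ hτ
      apply (hball _).le
      rw [Real.dist_eq, abs_lt]; constructor <;> linarith [hτ.1, hτ.2]
    rw [intervalIntegral.integral_const, smul_eq_mul] at this
    linarith
  have hVV := hmin' s x' hs1 (hs2.le.trans ht0.2) hx'
  simp only [hV] at hVV
  have hG : ∀ s, GG u (fun z => η (x' - z)) s = U s x' := fun s => rfl
  rw [hG, hG] at hg
  nlinarith

lemma gap {u : ℝ → E2 → ℝ} {K s1 : ℝ} (hu : SupSol u K s1) {R M δ : ℝ} (hδ : 0 < δ)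
    (hM : 0 ≤ M) : ∃ C : ℝ, 0 ≤ C ∧ ∀ a b, GoodOn u R a b → Quad M R (u a) → ∀ x0 : E2, ‖x0‖ + 2 * δ ≤ R →
     ∀ t, a ≤ t → t ≤ b → u a x0 - C * (t - a) ≤ u t x0 := by
  have hK := hu.K_nonneg
  set L := M + (K + 2 * M * δ) / δ ^ 2 with hL
  set C := 4 * L + R * (M + 2 * L * δ) + K + 2 with hC
  refine ⟨max C 0, le_max_right _ _, ?_⟩
  intro a b hgood hq x0 hx0 t hat htb
  suffices hs : u a x0 - C * (t - a) ≤ u t x0 by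
    have : C * (t - a) ≤ max C 0 * (t - a) := mul_le_mul_of_nonneg_right (le_max_left _ _) (by linarith)
    linarith
  set A := 2 * M + 6 * M * δ with hA
  have hA0 : 0 ≤ A := by positivity
  apply le_of_forall_pos_le_add
  intro ν hν
  have hcont : ∀ᶠ z in 𝓝 x0, u t z < u t x0 + ν / 2 :=
    (hu.reg t).continuous.continuousAt.eventually (Iio_mem_nhds (by linarith))
  obtain ⟨ε, hε, hball⟩ := Metric.eventually_nhds_iff.1 hcont
  set r := min (min (δ / 2) (ε)) (ν / (2 * (A + 1))) with hr
  have hr0 : 0 < r := by positivity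
  have hrδ : r < δ := lt_of_le_of_lt ((min_le_left _ _).trans (min_le_left _ _)) (by linarith)
  have hrε : r ≤ ε := (min_le_left _ _).trans (min_le_right _ _)
  have hrν : A * r ≤ ν / 2 := by
    have : r ≤ ν / (2 * (A + 1)) := min_le_right _ _
    rw [le_div_iff₀ (by positivity)] at this
    nlinarith
  obtain ⟨η, h⟩ := exists_moll hr0
  have key := gap_eps hu hδ hM hgood hq hx0 hr0 hrδ h hL hC hat htb
  have hcx : Continuous (fun z : E2 => x0 - z) := by fun_prop
  have iη : ∫ z, η (x0 - z) = 1 := by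
    rw [integral_sub_left_eq_self η volume x0]; exact h.int
  have up : ∫ z, u t z * η (x0 - z) ≤ ∫ z, (u t x0 + ν / 2) * η (x0 - z) := by
    apply integral_mono
    · exact ((hu.reg t).continuous.mul (h.reg.continuous.comp hcx)).integrable_of_hasCompactSupport
          (refl_supp h.supp x0).mul_left
    · exact ((h.reg.continuous.comp hcx).integrable_of_hasCompactSupport (refl_supp h.supp x0)).const_mul _
    · intro z
      by_cases hz : r ≤ ‖x0 - z‖
      · simp [h.zero _ hz]
      · push Not at hz
        apply mul_le_mul_of_nonneg_right _ (h.nonneg _)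
        apply (hball _).le
        rw [dist_comm, dist_eq_norm]; linarith
  rw [integral_const_mul, iη, mul_one] at up
  linarith

lemma mono_slope {H : ℝ → ℝ} (hH : Continuous H) {a b : ℝ} (hab : a ≤ b)
    (h : ∀ t ∈ Set.Ico a b, ∀ r < 0, ∃ᶠ z in 𝓝[>] t, r < slope H t z) : H a ≤ H b := by
  have := image_le_of_liminf_slope_right_le_deriv_boundary (f := fun t => - H t) (a := a) (b := b)
    (B := fun _ => - H a) (B' := fun _ => 0) hH.neg.continuousOn le_rfl continuousOn_const
    (fun x _ => hasDerivWithinAt_const _ _ _) (fun x hx r hr => by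
      refine (h x hx (-r) (by linarith)).mono fun z hz => ?_
      have e : slope (fun t => - H t) x z = - slope H x z := by
        simp only [slope_def_field]; ring
      rw [e]; linarith) (x := b) ⟨hab, le_rfl⟩
  simp only [neg_le_neg_iff] at this
  exact this

lemma sq_norm_le (z : E2) : ‖z‖ ^ 2 ≤ z 0 ^ 2 + z 1 ^ 2 := by
  have h : ‖z‖ ≤ Real.sqrt (z 0 ^ 2 + z 1 ^ 2) := by
    rw [pi_norm_le_iff_of_nonneg (Real.sqrt_nonneg _)]
    intro i
    rw [Real.norm_eq_abs]
    apply Real.abs_le_sqrt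
    fin_cases i <;> simp <;> positivity
  calc ‖z‖ ^ 2 ≤ Real.sqrt (z 0 ^ 2 + z 1 ^ 2) ^ 2 := by gcongr
    _ = _ := Real.sq_sqrt (by positivity)

lemma quad_mono {M M' R : ℝ} (h : M ≤ M') {g : E2 → ℝ} (hq : Quad M R g) : Quad M' R g := by
  intro x hx
  obtain ⟨p, hp, hz⟩ := hq x hx
  refine ⟨p, Metric.closedBall_subset_closedBall h hp, fun z hz' => le_trans ?_ (hz z hz')⟩
  have : M * ((z 0 - x 0) ^ 2 + (z 1 - x 1) ^ 2) ≤ M' * ((z 0 - x 0) ^ 2 + (z 1 - x 1) ^ 2) :=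
    mul_le_mul_of_nonneg_right h (by positivity)
  linarith

lemma clm_E2 (φ : E2 →L[ℝ] ℝ) (v : E2) :
    φ v = φ (Pi.single 0 1) * v 0 + φ (Pi.single 1 1) * v 1 := by
  have : v = v 0 • Pi.single 0 1 + v 1 • Pi.single 1 1 := by
    ext i; fin_cases i <;> simp
  conv_lhs => rw [this]
  rw [map_add, map_smul, map_smul, smul_eq_mul, smul_eq_mul]; ring

lemma quad_exists {g : E2 → ℝ} (hg : ContDiff ℝ 2 g) (R : ℝ) : ∃ M : ℕ, Quad M R g := by
  set B := Metric.closedBall (0 : E2) R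
  have hB : IsCompact B := isCompact_closedBall _ _
  have hcv : Convex ℝ B := convex_closedBall _ _
  have h1 : ContDiff ℝ 1 (fderiv ℝ g) := hg.fderiv_right (by norm_num)
  have h2 : Continuous (fderiv ℝ (fderiv ℝ g)) := h1.continuous_fderiv (by norm_num)
  obtain ⟨M0, hM0⟩ := hB.exists_bound_of_continuousOn h1.continuous.continuousOn
  obtain ⟨L, hL⟩ := hB.exists_bound_of_continuousOn (f := fderiv ℝ (fderiv ℝ g)) h2.continuousOn
  obtain ⟨M, hM⟩ := exists_nat_ge (max M0 L)
  refine ⟨M, fun x hx => ⟨fun i => pd g i x, ?_, fun z hz => ?_⟩⟩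
  · simp only [Metric.mem_closedBall, dist_zero_right]
    rw [pi_norm_le_iff_of_nonneg (by positivity)]
    intro i
    refine ((fderiv ℝ g x).le_opNorm _).trans ?_
    have : ‖(Pi.single i 1 : E2)‖ = 1 := by rw [Pi.norm_single]; simp
    rw [this, mul_one]
    exact (hM0 x hx).trans ((le_max_left _ _).trans hM)
  · have hL0 : 0 ≤ L := (norm_nonneg _).trans (hL x hx)
    have lip : ∀ y ∈ segment ℝ x z, ‖fderiv ℝ g y - fderiv ℝ g x‖ ≤ L * ‖z - x‖ := by
      intro y hy
      have hyB : y ∈ B := hcv.segment_subset hx hz hy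
      refine (hcv.norm_image_sub_le_of_norm_fderiv_le
        (fun w _ => (h1.differentiable (by norm_num)) w) hL hx hyB).trans ?_
      gcongr
      have := norm_sub_le_of_mem_segment hy
      exact this
    have := (convex_segment x z).norm_image_sub_le_of_norm_fderiv_le'
      (fun w _ => (hg.differentiable (by norm_num)) w) lip (left_mem_segment ℝ x z) (right_mem_segment ℝ x z)
    rw [Real.norm_eq_abs, clm_E2] at this
    have h3 := (abs_le.1 this).1
    have h4 := sq_norm_le (z - x)
    simp only [Pi.sub_apply] at h3 h4
    have h5 : L * ‖z - x‖ ^ 2 ≤ M * ((z 0 - x 0) ^ 2 + (z 1 - x 1) ^ 2) :=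
      mul_le_mul ((le_max_right _ _).trans hM) h4 (by positivity) (by positivity)
    unfold pd
    nlinarith

lemma quad_closed {u : ℝ → E2 → ℝ} {K s1 : ℝ} (hu : SupSol u K s1) (M R : ℝ) :
    IsClosed {t | Quad M R (u t)} := by
  have : {t | Quad M R (u t)} = ⋂ x ∈ Metric.closedBall (0 : E2) R,
      Prod.snd '' {q : (Metric.closedBall (0 : E2) M) × ℝ | ∀ z ∈ Metric.closedBall (0 : E2) R,
        u q.2 x + ((q.1 : E2) 0 * (z 0 - x 0) + (q.1 : E2) 1 * (z 1 - x 1))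
          - M * ((z 0 - x 0) ^ 2 + (z 1 - x 1) ^ 2) ≤ u q.2 z} := by
    ext t
    simp only [Quad, Set.mem_ofPred_eq, Set.mem_iInter, Set.mem_image, Prod.exists, Subtype.exists,
      exists_eq_right, exists_prop]
  rw [this]
  refine isClosed_biInter fun x _ => ?_
  have : CompactSpace (Metric.closedBall (0 : E2) M) :=
    isCompact_iff_compactSpace.1 (isCompact_closedBall _ _)
  apply isClosedMap_snd_of_compactSpace
  simp only [Set.ofPred_forall]
  refine isClosed_biInter fun z _ => ?_
  have c1 : ∀ z, Continuous fun q : (Metric.closedBall (0 : E2) M) × ℝ => u q.2 z :=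
    fun z => (hu.cont z).comp continuous_snd
  have c2 : ∀ i, Continuous fun q : (Metric.closedBall (0 : E2) M) × ℝ => (q.1 : E2) i :=
    fun i => (continuous_apply i).comp (continuous_subtype_val.comp continuous_fst)
  exact isClosed_le (((c1 x).add (((c2 0).mul continuous_const).add
    ((c2 1).mul continuous_const))).sub continuous_const) (c1 z)

def HH (u : ℝ → E2 → ℝ) (ψ : E2 → ℝ) (t : ℝ) : ℝ := GG u ψ t - ∫ τ in (0:ℝ)..t, NN u ψ τ

lemma HH_cont {u : ℝ → E2 → ℝ} {K s1 : ℝ} (hu : SupSol u K s1) {R : ℝ} {ψ : E2 → ℝ}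
    (h : Test R ψ) : Continuous (HH u ψ) :=
  (GG_cont hu h.reg.continuous h.supp).sub
    (intervalIntegral.continuous_primitive (fun a b => (NN_cont hu h.reg h.supp).intervalIntegrable a b) 0)

lemma HH_iff {u : ℝ → E2 → ℝ} {K s1 : ℝ} (hu : SupSol u K s1) {R : ℝ} {ψ : E2 → ℝ}
    (h : Test R ψ) (t t' : ℝ) : HH u ψ t ≤ HH u ψ t' ↔
    ∫ τ in t..t', NN u ψ τ ≤ GG u ψ t' - GG u ψ t := by
  have hi := fun a b => (NN_cont hu h.reg h.supp).intervalIntegrable (μ := volume) a b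
  have := intervalIntegral.integral_add_adjacent_intervals (hi 0 t) (hi t t')
  unfold HH
  constructor <;> intro <;> linarith

def GoodNear (u : ℝ → E2 → ℝ) (R s1 t : ℝ) : Prop :=
  ∃ ε > 0, GoodOn u R (max s1 (t - ε)) (t + ε)

lemma GoodOn.mono {u : ℝ → E2 → ℝ} {R a b a' b' : ℝ} (h : GoodOn u R a b) (ha : a ≤ a') (hb : b' ≤ b) :
    GoodOn u R a' b' := fun ψ hψ t t' h1 h2 h3 => h ψ hψ t t' (ha.trans h1) h2 (h3.trans hb)

lemma goodNear_open (u : ℝ → E2 → ℝ) (R s1 : ℝ) : IsOpen {t | GoodNear u R s1 t} := by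
  rw [Metric.isOpen_iff]
  rintro t ⟨ε, hε, h⟩
  refine ⟨ε / 2, by positivity, fun t' ht' => ⟨ε / 2, by positivity, h.mono ?_ ?_⟩⟩
  · rw [Metric.mem_ball, Real.dist_eq, abs_lt] at ht'
    exact max_le_max le_rfl (by linarith)
  · rw [Metric.mem_ball, Real.dist_eq, abs_lt] at ht'
    linarith

lemma goodNear_lt (u : ℝ → E2 → ℝ) {R s1 t : ℝ} (h : t < s1) : GoodNear u R s1 t := by
  refine ⟨(s1 - t) / 2, by linarith, fun ψ _ a b h1 h2 h3 => ?_⟩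
  have := (le_max_left _ _).trans h1
  linarith

lemma goodNear_right {u : ℝ → E2 → ℝ} {K s1 : ℝ} (hu : SupSol u K s1) {R t : ℝ} (ht : s1 ≤ t)
    (h : GoodNear u R s1 t) {ψ : E2 → ℝ} (hψ : Test R ψ) {r : ℝ} (hr : r < 0) :
    ∃ᶠ z in 𝓝[>] t, r < slope (HH u ψ) t z := by
  obtain ⟨ε, hε, h⟩ := h
  apply Eventually.frequently
  filter_upwards [Ioo_mem_nhdsGT (show t < t + ε by linarith)] with z hz
  have := (HH_iff hu hψ t z).2 (h ψ hψ t z (max_le ht (by linarith)) hz.1.le hz.2.le)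
  refine lt_of_lt_of_le hr ?_
  rw [slope_def_field]
  exact div_nonneg (by linarith) (by linarith [hz.1])

lemma gap_good {u : ℝ → E2 → ℝ} {K s1 : ℝ} (hu : SupSol u K s1) {R c d : ℝ} (hc : s1 ≤ c)
    (h : ∀ t, c < t → t < d → GoodNear u R s1 t) : GoodOn u R c d := by
  intro ψ hψ t t' h1 h2 h3
  rw [← HH_iff hu hψ]
  have key : ∀ x, c < x → x ≤ t' → HH u ψ x ≤ HH u ψ t' := fun x hx hx' =>
    mono_slope (HH_cont hu hψ) hx' fun τ hτ r hr =>
      goodNear_right hu (hc.trans (hx.le.trans hτ.1)) (h τ (hx.trans_le hτ.1) (hτ.2.trans_le h3)) hψ hr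
  rcases h2.eq_or_lt with e | e
  · rw [e]
  have ht : Tendsto (HH u ψ) (𝓝[>] t) (𝓝 (HH u ψ t)) :=
    (HH_cont hu hψ).continuousAt.tendsto.mono_left nhdsWithin_le_nhds
  refine le_of_tendsto ht ?_
  filter_upwards [Ioo_mem_nhdsGT e] with x hx
  exact key x (h1.trans_lt hx.1) hx.2.le

lemma Lop_lower {u : ℝ → E2 → ℝ} {K s1 : ℝ} (hu : SupSol u K s1) {R M : ℝ} (hM : 0 ≤ M) {t : ℝ}
    (hq : Quad M R (u t)) {x : E2} (hx : ‖x‖ < R) :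
    - (4 * M + R * M + 1) ≤ Lop (u t) x + (u t x ^ 2 - u t x) := by
  obtain ⟨p, hp, h⟩ := hq x (by simp [hx.le])
  have hp0 : ∀ i, |p i| ≤ M := fun i => (abs_coord_le p i).trans (by simpa using hp)
  have hloc : IsLocalMin (fun y => u t y - quadf (u t x) M p x y) x := by
    have : ∀ᶠ y in 𝓝 x, ‖y‖ < R := continuous_norm.continuousAt.eventually (Iio_mem_nhds hx)
    filter_upwards [this] with y hy
    have := h y (by simp [hy.le])
    have e : quadf (u t x) M p x x = u t x := by simp [quadf]
    rw [e]
    unfold quadf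
    linarith
  obtain ⟨g1, g2⟩ := min_quad (hu.reg t) hloc
  have g3 : ∀ i, x i * pd (u t) i x ≤ R * M := by
    intro i
    rw [g1, sub_self, mul_zero, sub_zero]
    refine (le_abs_self _).trans ?_
    rw [abs_mul]
    exact mul_le_mul ((abs_coord_le x i).trans hx.le) (hp0 i) (abs_nonneg _) ((norm_nonneg x).trans hx.le)
  unfold Lop
  nlinarith [g3 0, g3 1, sq_nonneg (u t x - 1/2)]

lemma claim1 {u : ℝ → E2 → ℝ} {K s1 : ℝ} (hu : SupSol u K s1) {R M δ a0 ε : ℝ} (hδ : 0 < δ)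
    (hM : 0 ≤ M) (hP : ∀ t, |t - a0| < ε → ¬ GoodNear u R s1 t → Quad M R (u t)) :
    ∃ C : ℝ, 0 ≤ C ∧ ∀ a b, ¬ GoodNear u R s1 a → |a - a0| < ε → |b - a0| < ε → a ≤ b →
      ∀ x : E2, ‖x‖ + 2 * δ ≤ R → u a x - C * (b - a) ≤ u b x := by
  obtain ⟨C1, hC1, hgap⟩ := gap hu (R := R) hδ hM
  set C0 := 4 * M + R * M + 1 with hC0
  set C := max C1 (C0 + 1) with hC
  refine ⟨C, hC1.trans (le_max_left _ _), fun a b haP ha hb hab x hx => ?_⟩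
  have hs : ∀ t, ¬ GoodNear u R s1 t → s1 ≤ t := fun t ht => by
    by_contra h; push Not at h; exact ht (goodNear_lt u h)
  have hI : ∀ t, a ≤ t → t ≤ b → |t - a0| < ε := fun t h1 h2 => by
    rw [abs_lt] at *; constructor <;> linarith
  set S := {t | u a x - C * (t - a) ≤ u t x} with hS
  have hSc : IsClosed S := by
    have := hu.cont x
    exact isClosed_le (by fun_prop) (by fun_prop)
  have : Set.Icc a b ⊆ S := by
    apply IsClosed.Icc_subset_of_forall_mem_nhdsGT_of_Icc_subset
    · exact hSc.inter isClosed_Icc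
    · simp [hS]
    · rintro t ⟨hat, htb⟩ hsub
      have ht := hsub ⟨hat, le_rfl⟩
      by_cases htP : GoodNear u R s1 t
      · set Q := {τ | ¬ GoodNear u R s1 τ} ∩ Set.Icc a t with hQ
        have hQc : IsCompact Q := isCompact_Icc.inter_left (goodNear_open u R s1).isClosed_compl
        have hQn : Q.Nonempty := ⟨a, haP, le_rfl, hat⟩
        set a' := sSup Q with ha'
        have ha'Q : a' ∈ Q := hQc.sSup_mem hQn
        obtain ⟨ha'P, ha'1, ha'2⟩ := ha'Q
        have hup : ∀ τ ∈ Q, τ ≤ a' := fun τ hτ => le_csSup hQc.bddAbove hτ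
        obtain ⟨e, he, hball⟩ := Metric.isOpen_iff.1 (goodNear_open u R s1) t htP
        have hgood : GoodOn u R a' (t + e) := by
          refine gap_good hu (hs a' ha'P) fun τ h1 h2 => ?_
          rcases le_or_gt τ t with h3 | h3
          · by_contra hcon
            have := hup τ ⟨hcon, ha'1.trans h1.le, h3⟩
            linarith
          · apply hball
            rw [Metric.mem_ball, Real.dist_eq, abs_lt]; constructor <;> linarith
        filter_upwards [Ioo_mem_nhdsGT (show t < t + e by linarith)] with z hz
        have k1 := hgap a' (t + e) hgood (hP a' (hI a' ha'1 (ha'2.trans htb.le)) ha'P) x hx z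
          (ha'2.trans hz.1.le) hz.2.le
        have k2 : u a x - C * (a' - a) ≤ u a' x := hsub ⟨ha'1, ha'2⟩
        have k3 : C1 * (z - a') ≤ C * (z - a') :=
          mul_le_mul_of_nonneg_right (le_max_left _ _) (by linarith [hz.1])
        show u a x - C * (z - a) ≤ u z x
        linarith
      · obtain ⟨d, hd, hle⟩ := hu.eq t (hs t htP) x
        have hlow := Lop_lower hu hM (hP t (hI t hat htb.le) htP) (x := x) (by linarith)
        have hCd : - C < d := by
          have : C0 + 1 ≤ C := le_max_right _ _
          linarith
        have := (hasDerivWithinAt_iff_tendsto_slope' (by simp)).1 hd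
        have ev := this.eventually (Ioi_mem_nhds hCd)
        filter_upwards [ev, self_mem_nhdsWithin] with z hz hz2
        rw [slope_def_field, lt_div_iff₀ (by simpa using hz2)] at hz
        have k2 : u a x - C * (t - a) ≤ u t x := ht
        show u a x - C * (z - a) ≤ u z x
        linarith
  exact this ⟨hab, le_rfl⟩

lemma claim2 {u : ℝ → E2 → ℝ} {K s1 : ℝ} (hu : SupSol u K s1) {R t C e : ℝ} (he : 0 < e) (ht : s1 ≤ t)
    {ψ : E2 → ℝ} (hψ : Test R ψ)
    (hC : ∀ z, t < z → z < t + e → ∀ x, ψ x ≠ 0 → u t x - C * (z - t) ≤ u z x) {r : ℝ} (hr : r < 0) :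
    ∃ᶠ z in 𝓝[>] t, r < slope (HH u ψ) t z := by
  set g : E2 → ℝ := fun x => Lop (u t) x + (u t x ^ 2 - u t x) with hg
  have hgc : Continuous g := by
    have := Lop_cont (hu.reg t)
    have := (hu.reg t).continuous
    fun_prop
  have hψc := hψ.reg.continuous
  have hev : ∀ᶠ z in 𝓝[>] t, t < z ∧ z < t + e := Ioo_mem_nhdsGT (show t < t + e by linarith)
  have T1 : Tendsto (fun z => ∫ x, min ((u z x - u t x) / (z - t)) (g x) * ψ x) (𝓝[>] t)
      (𝓝 (∫ x, g x * ψ x)) := by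
    apply tendsto_integral_filter_of_dominated_convergence (fun x => (|C| + |g x|) * ψ x)
    · refine Eventually.of_forall fun z => ?_
      have := (hu.reg t).continuous
      have := (hu.reg z).continuous
      have : Continuous fun x => min ((u z x - u t x) / (z - t)) (g x) * ψ x := by
        refine Continuous.mul (Continuous.min ?_ hgc) hψc
        exact Continuous.div_const (by fun_prop) _
      exact this.aestronglyMeasurable
    · filter_upwards [hev] with z hz
      refine ae_of_all _ fun x => ?_
      rw [norm_mul, Real.norm_eq_abs, Real.norm_eq_abs, abs_of_nonneg (hψ.nonneg x)]
      by_cases h0 : ψ x = 0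
      · simp [h0]
      refine mul_le_mul_of_nonneg_right ?_ (hψ.nonneg x)
      have k := hC z hz.1 hz.2 x h0
      have k1 : - C ≤ (u z x - u t x) / (z - t) := by
        rw [le_div_iff₀ (by linarith [hz.1])]; linarith
      rw [abs_le]
      constructor
      · apply le_min
        · linarith [le_abs_self C, abs_nonneg (g x)]
        · linarith [neg_abs_le (g x), abs_nonneg C]
      · exact (min_le_right _ _).trans (by linarith [le_abs_self (g x), abs_nonneg C])
    · refine Continuous.integrable_of_hasCompactSupport (by fun_prop) hψ.supp.mul_left
    · refine ae_of_all _ fun x => ?_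
      obtain ⟨d, hd, hle⟩ := hu.eq t ht x
      have h1 := (hasDerivWithinAt_iff_tendsto_slope' (by simp)).1 hd
      have h2 : Tendsto (fun z => min (slope (fun τ => u τ x) t z) (g x)) (𝓝[>] t) (𝓝 (min d (g x))) :=
        h1.min tendsto_const_nhds
      rw [min_eq_right hle] at h2
      simp only [slope_def_field] at h2
      exact h2.mul_const _
  have hNc := NN_cont hu hψ.reg hψ.supp
  have T2 : Tendsto (slope (fun s => ∫ τ in (0:ℝ)..s, NN u ψ τ) t) (𝓝[>] t) (𝓝 (NN u ψ t)) := by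
    have := intervalIntegral.integral_hasDerivAt_right (hNc.intervalIntegrable 0 t)
      (hNc.stronglyMeasurableAtFilter _ _) hNc.continuousAt
    exact (hasDerivWithinAt_iff_tendsto_slope' (by simp)).1 this.hasDerivWithinAt
  have T3 := T1.sub T2
  rw [NN_eq hu hψ.reg hψ.supp, sub_self] at T3
  apply Eventually.frequently
  filter_upwards [hev, T3.eventually (Ioi_mem_nhds hr)] with z hz hz2
  refine lt_of_lt_of_le hz2 ?_
  have e1 : slope (HH u ψ) t z = slope (GG u ψ) t z - slope (fun s => ∫ τ in (0:ℝ)..s, NN u ψ τ) t z := by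
    simp only [slope_def_field, HH]; ring
  rw [e1]
  apply sub_le_sub_right
  have ct := (hu.reg t).continuous
  have cz := (hu.reg z).continuous
  have I1 : ∀ s, Integrable (fun x => u s x * ψ x) := fun s =>
    ((hu.reg s).continuous.mul hψc).integrable_of_hasCompactSupport hψ.supp.mul_left
  have cq : Continuous fun x => (u z x - u t x) / (z - t) := Continuous.div_const (by fun_prop) _
  have e2 : slope (GG u ψ) t z = ∫ x, ((u z x - u t x) / (z - t)) * ψ x := by
    rw [slope_def_field]
    unfold GG
    rw [← integral_sub (I1 z) (I1 t), ← integral_div]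
    congr 1; funext x; ring
  rw [e2]
  apply integral_mono
  · exact ((cq.min hgc).mul hψc).integrable_of_hasCompactSupport hψ.supp.mul_left
  · exact (cq.mul hψc).integrable_of_hasCompactSupport hψ.supp.mul_left
  · intro x
    exact mul_le_mul_of_nonneg_right (min_le_left _ _) (hψ.nonneg x)

lemma test_room {R : ℝ} {ψ : E2 → ℝ} (hψ : Test R ψ) :
    ∃ δ > 0, ∀ x, ψ x ≠ 0 → ‖x‖ + 2 * δ ≤ R := by
  rcases (tsupport ψ).eq_empty_or_nonempty with h | h
  · refine ⟨1, one_pos, fun x hx => ?_⟩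
    have : x ∈ tsupport ψ := subset_tsupport _ hx
    rw [h] at this; exact absurd this (by simp)
  · obtain ⟨y, hy, hmax⟩ := hψ.supp.isCompact.exists_isMaxOn h continuous_norm.continuousOn
    have hyR : ‖y‖ < R := by simpa using hψ.sub hy
    refine ⟨(R - ‖y‖) / 2, by linarith, fun x hx => ?_⟩
    have : ‖x‖ ≤ ‖y‖ := hmax (subset_tsupport _ hx)
    linarith

lemma all_good {u : ℝ → E2 → ℝ} {K s1 : ℝ} (hu : SupSol u K s1) (R t : ℝ) : GoodNear u R s1 t := by
  by_contra hcon
  set P := {t | ¬ GoodNear u R s1 t} with hPdef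
  have hPc : IsClosed P := (goodNear_open u R s1).isClosed_compl
  have : Nonempty P := ⟨⟨t, hcon⟩⟩
  have : CompleteSpace P := hPc.completeSpace_coe
  have hs : ∀ t, ¬ GoodNear u R s1 t → s1 ≤ t := fun t ht => by
    by_contra h; push Not at h; exact ht (goodNear_lt u h)
  obtain ⟨M, ⟨a0, ha0⟩, hint⟩ := nonempty_interior_of_iUnion_of_closed
    (f := fun M : ℕ => {t : P | Quad M R (u t)})
    (fun M => (quad_closed hu M R).preimage continuous_subtype_val)
    (by
      ext t
      simp only [Set.mem_iUnion, Set.mem_ofPred_eq, Set.mem_univ, iff_true]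
      exact quad_exists (hu.reg t) R)
  rw [mem_interior_iff_mem_nhds, Metric.mem_nhds_iff] at hint
  obtain ⟨ε, hε, hball⟩ := hint
  have hP : ∀ t, |t - a0| < ε → ¬ GoodNear u R s1 t → Quad M R (u t) := fun t h1 h2 =>
    hball (show (⟨t, h2⟩ : P) ∈ Metric.ball ⟨a0, ha0⟩ ε by
      rw [Metric.mem_ball, Subtype.dist_eq, Real.dist_eq]; exact h1)
  apply ha0
  refine ⟨ε / 2, by positivity, fun ψ hψ t t' h1 h2 h3 => ?_⟩
  rw [← HH_iff hu hψ]
  obtain ⟨δ, hδ, hroom⟩ := test_room hψ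
  obtain ⟨C, hC, hcl⟩ := claim1 hu hδ (Nat.cast_nonneg M) hP
  have h1a : s1 ≤ t := (le_max_left _ _).trans h1
  have h1b : a0 - ε / 2 ≤ t := (le_max_right _ _).trans h1
  refine mono_slope (HH_cont hu hψ) h2 fun τ hτ r hr => ?_
  by_cases hg : GoodNear u R s1 τ
  · exact goodNear_right hu (h1a.trans hτ.1) hg hψ hr
  · refine claim2 hu (e := ε / 2) (C := C) (by positivity) (h1a.trans hτ.1) hψ (fun z hz1 hz2 x hx => ?_) hr
    refine hcl τ z hg ?_ ?_ hz1.le x (hroom x hx)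
    · rw [abs_lt]; constructor <;> linarith [hτ.1, hτ.2]
    · rw [abs_lt]; constructor <;> linarith [hτ.1, hτ.2]

lemma weak {u : ℝ → E2 → ℝ} {K s1 : ℝ} (hu : SupSol u K s1) {R : ℝ} {ψ : E2 → ℝ} (hψ : Test R ψ)
    {t t' : ℝ} (h1 : s1 ≤ t) (h2 : t ≤ t') : ∫ τ in t..t', NN u ψ τ ≤ GG u ψ t' - GG u ψ t :=
  gap_good hu (d := t') le_rfl (fun τ _ _ => all_good hu R τ) ψ hψ t t' h1 h2 le_rfl

lemma rho_cd {n} : ContDiff ℝ n rho2 := by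
  unfold rho2
  have h : ∀ i : Fin 2, ContDiff ℝ n (fun z : E2 => z i) := fun i => contDiff_apply ℝ ℝ i
  exact (((((h 0).pow 2).add ((h 1).pow 2)).neg.div_const _).exp).div_const _

lemma rho_pos (z : E2) : 0 < rho2 z := by unfold rho2; positivity

lemma rho_pd (i : Fin 2) (z : E2) : pd rho2 i z = - (z i / 2) * rho2 z := by
  have h : ∀ i : Fin 2, HasFDerivAt (fun z : E2 => z i) (ContinuousLinearMap.proj i : E2 →L[ℝ] ℝ) z :=
    fun i => hasFDerivAt_apply i z
  have h2 := ((((h 0).pow 2).add ((h 1).pow 2)).const_mul (-(1/4))).exp.mul_const ((4 * Real.pi)⁻¹)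
  have h3 : rho2 = fun x : E2 => Real.exp (-(1/4) * ((fun z : E2 => z 0) ^ 2 + (fun z : E2 => z 1) ^ 2) x) * (4 * Real.pi)⁻¹ := by
    funext x; simp only [rho2, div_eq_mul_inv]; congr 2
    simp only [Pi.add_apply, Pi.pow_apply]; ring
  unfold pd
  rw [h3]
  erw [h2.fderiv]
  fin_cases i <;> simp <;> ring

lemma rho_eq : rho2 = fun z : E2 => ∏ i : Fin 2, (Real.exp (-(1/4) * (z i) ^ 2) / (2 * √π)) := by
  funext z
  rw [Fin.prod_univ_two]
  unfold rho2
  rw [div_mul_div_comm, ← Real.exp_add]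
  congr 1
  · congr 1; ring
  · have := Real.mul_self_sqrt Real.pi_pos.le
    linear_combination (-4) * this

lemma rho_integrable : Integrable rho2 := by
  rw [rho_eq]
  exact Integrable.fintype_prod (f := fun (i : Fin 2) (x : ℝ) => Real.exp (-(1/4) * x ^ 2) / (2 * √π))
    fun i => (integrable_exp_neg_mul_sq (by norm_num)).div_const _

lemma rho_integral : ∫ z, rho2 z = 1 := by
  rw [rho_eq]
  have := integral_fintype_prod_volume_eq_prod (𝕜 := ℝ) (ι := Fin 2)
    (f := fun (i : Fin 2) (x : ℝ) => Real.exp (-(1/4) * x ^ 2) / (2 * √π))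
  rw [this]
  have h1 : ∫ x : ℝ, Real.exp (-(1/4) * x ^ 2) / (2 * √π) = 1 := by
    rw [integral_div, integral_gaussian]
    have : √(π / (1/4)) = 2 * √π := by
      rw [show π / (1/4) = 2 ^ 2 * π by ring, Real.sqrt_mul (by norm_num), Real.sqrt_sq (by norm_num)]
    rw [this]
    exact div_self (by positivity)
  rw [Fin.prod_univ_two]
  simp only [h1, mul_one]

def psi (r : ℝ) (z : E2) : ℝ := cut r z * rho2 z

lemma psi_test {r : ℝ} (hr : 0 < r) : Test (r + 1) (psi r) := by
  have hs : tsupport (psi r) ⊆ tsupport (cut r) := tsupport_mul_subset_left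
  refine ⟨(cut_c2 r).mul rho_cd, (cut_supp hr).mul_right, ?_, fun z => mul_nonneg (cut_nonneg r z) (rho_pos z).le⟩
  exact (hs.trans (cut_supp_sub hr)).trans (Metric.closedBall_subset_ball (by linarith))

lemma psi_pd (r : ℝ) (i : Fin 2) (z : E2) :
    pd (psi r) i z = (pd (cut r) i z + cut r z * (-(z i / 2))) * rho2 z := by
  unfold psi
  rw [pd_mul (((cut_c2 r).differentiable (by norm_num)) z)
    (((rho_cd (n := 1)).differentiable (by norm_num)) z), rho_pd]
  ring

lemma half_pd (i : Fin 2) (z : E2) : pd (fun y : E2 => -(y i / 2)) i z = -(1/2) := by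
  have h : HasFDerivAt (fun z : E2 => -(z i / 2)) _ z :=
    ((hasFDerivAt_apply (𝕜 := ℝ) i z).mul_const ((2:ℝ)⁻¹)).neg
  unfold pd
  rw [h.fderiv]
  simp

lemma psi_pd2 (r : ℝ) (i : Fin 2) (z : E2) :
    pd (fun y => pd (psi r) i y) i z = (pd (fun y => pd (cut r) i y) i z - z i * pd (cut r) i z
      + cut r z * (z i ^ 2 / 4 - 1 / 2)) * rho2 z := by
  simp_rw [psi_pd]
  have dc : DifferentiableAt ℝ (cut r) z := ((cut_c2 r).differentiable (by norm_num)) z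
  have dp : DifferentiableAt ℝ (fun y => pd (cut r) i y) z :=
    ((pd_c1 (cut_c2 r) i).differentiable (by norm_num)) z
  have dh : DifferentiableAt ℝ (fun y : E2 => -(y i / 2)) z :=
    (((hasFDerivAt_apply (𝕜 := ℝ) i z).mul_const ((2:ℝ)⁻¹)).neg).differentiableAt
  have dch : DifferentiableAt ℝ (fun y : E2 => cut r y * (-(y i / 2))) z := dc.mul dh
  have dr : DifferentiableAt ℝ rho2 z := ((rho_cd (n := 1)).differentiable (by norm_num)) z
  have ds : DifferentiableAt ℝ (fun y => pd (cut r) i y + cut r y * (-(y i / 2))) z := dp.add dch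
  have e : pd (fun y => pd (cut r) i y + cut r y * (-(y i / 2))) i z =
      pd (fun y => pd (cut r) i y) i z + pd (fun y => cut r y * (-(y i / 2))) i z := by
    have h := (dp.hasFDerivAt.add dch.hasFDerivAt)
    have h' : HasFDerivAt (fun y => pd (cut r) i y + cut r y * (-(y i / 2))) _ z := h
    have h'' := congrArg (fun φ : E2 →L[ℝ] ℝ => φ (Pi.single i 1)) h'.fderiv
    exact h''
  rw [pd_mul ds dr, e, pd_mul dc dh, rho_pd, half_pd]
  ring

lemma psi_Aop {r : ℝ} (hr : 0 < r) (z : E2) : -(12 / r ^ 2) * psi r z ≤ Aop (psi r) z := by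
  have e : Aop (psi r) z = ((6 * max (qq r z) 0) * ((2 * z 0 / r ^ 2) ^ 2 + (2 * z 1 / r ^ 2) ^ 2)
      - 2 * (3 * max (qq r z) 0 ^ 2) * (2 / r ^ 2)
      + (3 * max (qq r z) 0 ^ 2) * ((z 0 ^ 2 + z 1 ^ 2) / r ^ 2)) * rho2 z := by
    unfold Aop lap2
    rw [Fin.sum_univ_two, psi_pd2, psi_pd2, psi_pd, psi_pd, cut_pd2, cut_pd2, cut_pd, cut_pd]
    unfold psi
    ring
  rw [e]
  unfold psi
  rw [← mul_assoc]
  refine mul_le_mul_of_nonneg_right ?_ (rho_pos z).le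
  unfold cut mm
  rcases le_total (qq r z) 0 with h | h
  · rw [max_eq_right h]; simp
  · rw [max_eq_left h]
    set m := qq r z with hm
    have hS : (z 0 ^ 2 + z 1 ^ 2) / r ^ 2 = 1 - m := by rw [hm]; unfold qq; ring
    have hm1 : m ≤ 1 := by
      have : 0 ≤ (z 0 ^ 2 + z 1 ^ 2) / r ^ 2 := by positivity
      linarith
    have hS2 : (2 * z 0 / r ^ 2) ^ 2 + (2 * z 1 / r ^ 2) ^ 2 = 4 * (1 - m) * (1 / r ^ 2) := by
      rw [← hS]; field_simp; ring
    rw [hS, hS2]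
    have hi : 0 ≤ 1 / r ^ 2 := by positivity
    have e2 : ∀ c, c / r ^ 2 = c * (1 / r ^ 2) := fun c => by ring
    rw [e2 12, e2 2]
    set k := 1 / r ^ 2
    have q1 : 0 ≤ k * (m * ((2 - m) * (1 - m))) :=
      mul_nonneg hi (mul_nonneg h (mul_nonneg (by linarith) (by linarith)))
    have q2 : 0 ≤ m ^ 2 * (1 - m) := mul_nonneg (by positivity) (by linarith)
    nlinarith

lemma psi_int {r : ℝ} (hr : 0 < r) : ∫ z, psi r z ≤ 1 := by
  rw [← rho_integral]
  have ht := psi_test hr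
  apply integral_mono (ht.reg.continuous.integrable_of_hasCompactSupport ht.supp) rho_integrable
  intro z
  have := mul_le_mul_of_nonneg_right (cut_le_one r z) (rho_pos z).le
  simpa [psi] using this

lemma NN_psi {u : ℝ → E2 → ℝ} {K s1 : ℝ} (hu : SupSol u K s1) {r : ℝ} (hr : 0 < r) (t : ℝ) :
    GG u (psi r) t ^ 2 - (1 + 12 / r ^ 2) * GG u (psi r) t ≤ NN u (psi r) t := by
  have ht := psi_test hr
  have cu := (hu.reg t).continuous
  have cp := ht.reg.continuous
  have cA := Aop_cont ht.reg
  set c := GG u (psi r) t with hc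
  set ε := 12 / r ^ 2 with hε
  have I0 : Integrable (psi r) := cp.integrable_of_hasCompactSupport ht.supp
  have I1 : Integrable (fun z => u t z * psi r z) := (cu.mul cp).integrable_of_hasCompactSupport ht.supp.mul_left
  have k : ∫ z, ((2 * c - 1 - ε) * (u t z * psi r z) - c ^ 2 * psi r z) ≤ NN u (psi r) t := by
    unfold NN
    apply integral_mono
    · exact (I1.const_mul _).sub (I0.const_mul _)
    · exact Continuous.integrable_of_hasCompactSupport (by fun_prop)
        ((Aop_supp ht.supp).mul_left.add ht.supp.mul_left)
    · intro z
      have h1 := mul_le_mul_of_nonneg_left (psi_Aop hr z) (hu.nonneg t z)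
      have h2 := mul_nonneg (sq_nonneg (u t z - c)) (ht.nonneg z)
      beta_reduce
      rw [← hε] at h1
      linarith
  rw [integral_sub (I1.const_mul _) (I0.const_mul _), integral_const_mul, integral_const_mul] at k
  have e : ∫ z, u t z * psi r z = c := rfl
  rw [e] at k
  have := mul_le_mul_of_nonneg_left (psi_int hr) (sq_nonneg c)
  linarith

lemma ode_contra {G N : ℝ → ℝ} {s1 K e : ℝ} (he : 0 ≤ e) (hG : Continuous G) (hN : Continuous N)
    (hw : ∀ t t', s1 ≤ t → t ≤ t' → ∫ τ in t..t', N τ ≤ G t' - G t)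
    (hGN : ∀ t, G t ^ 2 - (1 + e) * G t ≤ N t) (hK : ∀ t, G t ≤ K) (h0 : 1 + e < G s1) : False := by
  set g := G s1 with hg
  set c := g * (g - 1 - e) with hc
  have hc0 : 0 < c := mul_pos (by linarith) (by linarith)
  have hNc : ∀ t, g ≤ G t → c ≤ N t := fun t ht => by
    refine le_trans ?_ (hGN t)
    nlinarith
  have hS : ∀ b, Set.Icc s1 b ⊆ {t | g ≤ G t} := by
    intro b
    apply IsClosed.Icc_subset_of_forall_mem_nhdsGT_of_Icc_subset
    · exact (isClosed_le continuous_const hG).inter isClosed_Icc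
    · show g ≤ G s1
      exact hg.le
    · rintro t ⟨h1, h2⟩ hsub
      have ht : g ≤ G t := hsub ⟨h1, le_rfl⟩
      have hpos : 0 < N t := hc0.trans_le (hNc t ht)
      obtain ⟨d, hd, hball⟩ := Metric.eventually_nhds_iff.1 (hN.continuousAt.eventually (Ioi_mem_nhds hpos))
      filter_upwards [Ioo_mem_nhdsGT (show t < t + d by linarith)] with z hz
      have k := hw t z h1 hz.1.le
      have k2 : 0 ≤ ∫ τ in t..z, N τ := by
        apply intervalIntegral.integral_nonneg hz.1.le
        intro τ hτ
        apply le_of_lt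
        apply hball
        rw [Real.dist_eq, abs_lt]; constructor <;> linarith [hτ.1, hτ.2, hz.2]
      show g ≤ G z
      linarith
  set T := s1 + |K| / c with hT
  have hT1 : s1 ≤ T := by
    have : 0 ≤ |K| / c := by positivity
    linarith
  have k := hw s1 T le_rfl hT1
  have k2 : ∫ τ in s1..T, c ≤ ∫ τ in s1..T, N τ := by
    apply intervalIntegral.integral_mono_on hT1 (by simp) (hN.intervalIntegrable _ _)
    intro τ hτ
    exact hNc τ (hS T hτ)
  rw [intervalIntegral.integral_const, smul_eq_mul] at k2
  have k3 : (T - s1) * c = |K| := by rw [hT]; field_simp; ring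
  have := hK T
  have := le_abs_self K
  linarith

lemma cut_tendsto (z : E2) : Tendsto (fun n : ℕ => cut n z) atTop (𝓝 1) := by
  have h1 : Tendsto (fun n : ℕ => (z 0 ^ 2 + z 1 ^ 2) / (n : ℝ) ^ 2) atTop (𝓝 0) :=
    tendsto_const_nhds.div_atTop ((tendsto_pow_atTop (by norm_num)).comp tendsto_natCast_atTop_atTop)
  have h2 : Tendsto (fun n : ℕ => qq n z) atTop (𝓝 1) := by
    have := h1.const_sub 1
    simpa [qq] using this
  have h3 := (mm_c2.continuous.tendsto 1).comp h2
  have e : mm 1 = 1 := by simp [mm]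
  rw [e] at h3
  exact h3

lemma sup_contra {u : ℝ → E2 → ℝ} {K s1 : ℝ} (hu : SupSol u K s1)
    (h0 : 1 < ∫ z, u s1 z * rho2 z) : False := by
  have cu := (hu.reg s1).continuous
  have cr := (rho_cd (n := 0)).continuous
  have T1 : Tendsto (fun n : ℕ => GG u (psi n) s1) atTop (𝓝 (∫ z, u s1 z * rho2 z)) := by
    unfold GG
    apply tendsto_integral_of_dominated_convergence (fun z => K * rho2 z)
    · intro n
      have := (cut_c2 n).continuous
      exact Continuous.aestronglyMeasurable (by unfold psi; fun_prop)
    · exact rho_integrable.const_mul K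
    · intro n
      refine ae_of_all _ fun z => ?_
      have hp : 0 ≤ psi n z := mul_nonneg (cut_nonneg _ z) (rho_pos z).le
      rw [Real.norm_eq_abs, abs_of_nonneg (mul_nonneg (hu.nonneg _ _) hp)]
      refine mul_le_mul (hu.le _ _) ?_ hp hu.K_nonneg
      have := mul_le_mul_of_nonneg_right (cut_le_one n z) (rho_pos z).le
      simpa [psi] using this
    · refine ae_of_all _ fun z => ?_
      have := ((cut_tendsto z).mul_const (rho2 z)).const_mul (u s1 z)
      simpa [psi] using this
  have T2 : Tendsto (fun n : ℕ => 1 + 12 / (n : ℝ) ^ 2) atTop (𝓝 1) := by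
    have h1 : Tendsto (fun n : ℕ => 12 / (n : ℝ) ^ 2) atTop (𝓝 0) :=
      tendsto_const_nhds.div_atTop ((tendsto_pow_atTop (by norm_num)).comp tendsto_natCast_atTop_atTop)
    simpa using h1.const_add 1
  obtain ⟨n, hn, hn0⟩ := ((T2.eventually_lt T1 h0).and (eventually_gt_atTop 0)).exists
  have hr : (0:ℝ) < n := by exact_mod_cast hn0
  have ht := psi_test hr
  refine ode_contra (G := GG u (psi n)) (N := NN u (psi n)) (s1 := s1) (K := K) (e := 12 / (n:ℝ)^2)
    (by positivity) (GG_cont hu ht.reg.continuous ht.supp) (NN_cont hu ht.reg ht.supp)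
    (fun t t' h1 h2 => weak hu ht h1 h2) (NN_psi hu hr) (fun t => ?_) hn
  have I0 : Integrable (psi n) := ht.reg.continuous.integrable_of_hasCompactSupport ht.supp
  have : GG u (psi n) t ≤ ∫ z, K * psi n z := by
    apply integral_mono
    · exact ((hu.reg t).continuous.mul ht.reg.continuous).integrable_of_hasCompactSupport ht.supp.mul_left
    · exact I0.const_mul _
    · intro z; exact mul_le_mul_of_nonneg_right (hu.le t z) (ht.nonneg z)
  rw [integral_const_mul] at this
  have := mul_le_mul_of_nonneg_left (psi_int hr) hu.K_nonneg
  linarith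

def hh (δ x : ℝ) : ℝ := x / (1 + δ * x)

lemma hh_deriv {δ x : ℝ} (h : 1 + δ * x ≠ 0) : HasDerivAt (hh δ) (1 / (1 + δ * x) ^ 2) x := by
  have h1 : HasDerivAt (fun x => 1 + δ * x) δ x := by
    simpa using ((hasDerivAt_id x).const_mul δ).const_add 1
  have := (hasDerivAt_id x).div h1 h
  refine HasDerivAt.congr_deriv (f := hh δ) this ?_
  simp only [id, one_mul]
  congr 1; ring

lemma hh1_deriv {δ x : ℝ} (h : 1 + δ * x ≠ 0) :
    HasDerivAt (fun x => 1 / (1 + δ * x) ^ 2) (-(2 * δ) / (1 + δ * x) ^ 3) x := by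
  have h1 : HasDerivAt (fun x => 1 + δ * x) δ x := by
    simpa using ((hasDerivAt_id x).const_mul δ).const_add 1
  have h2 := (hasDerivAt_const x (1:ℝ)).div (h1.pow 2) (pow_ne_zero 2 h)
  refine HasDerivAt.congr_deriv h2 ?_
  simp
  field_simp

lemma hh_Lop {δ : ℝ} (hδ : 0 < δ) {g : E2 → ℝ} (hg : ContDiff ℝ 2 g) (h0 : ∀ z, 0 ≤ g z) (z : E2) :
    Lop (fun y => hh δ (g y)) z + (hh δ (g z) ^ 2 - hh δ (g z)) ≤
      (1 / (1 + δ * g z) ^ 2) * (Lop g z - g z + g z ^ 2) := by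
  have hp : ∀ y, 0 < 1 + δ * g y := fun y => by have := mul_nonneg hδ.le (h0 y); linarith
  have dg : ∀ y, DifferentiableAt ℝ g y := hg.differentiable (by norm_num)
  have e1 : ∀ i y, pd (fun y => hh δ (g y)) i y = (1 / (1 + δ * g y) ^ 2) * pd g i y := fun i y =>
    pd_comp (dg y) (hh_deriv (hp y).ne') i
  have e2 : ∀ i, pd (fun y => pd (fun y => hh δ (g y)) i y) i z =
      -(2 * δ) / (1 + δ * g z) ^ 3 * pd g i z ^ 2 + (1 / (1 + δ * g z) ^ 2) * pd (fun y => pd g i y) i z := by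
    intro i
    simp_rw [e1]
    have hd := hh1_deriv (hp z).ne'
    rw [pd_mul (f := fun y => 1 / (1 + δ * g y) ^ 2)
      (hd.comp_hasFDerivAt z (dg z).hasFDerivAt).differentiableAt
      (((pd_c1 hg i).differentiable (by norm_num)) z), pd_comp (h := fun x => 1 / (1 + δ * x) ^ 2) (dg z) hd]
    ring
  have key : hh δ (g z) ^ 2 - hh δ (g z) ≤ (1 / (1 + δ * g z) ^ 2) * (- g z + g z ^ 2) := by
    unfold hh
    have a1 : (g z / (1 + δ * g z)) ^ 2 = (1 / (1 + δ * g z) ^ 2) * g z ^ 2 := by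
      rw [div_pow]; ring
    have a2 : (1 / (1 + δ * g z) ^ 2) * g z ≤ g z / (1 + δ * g z) := by
      rw [one_div_mul_eq_div]
      apply div_le_div_of_nonneg_left (h0 z) (hp z)
      have : 1 ≤ 1 + δ * g z := by have := mul_nonneg hδ.le (h0 z); linarith
      nlinarith
    linarith
  have hneg : ∀ i, -(2 * δ) / (1 + δ * g z) ^ 3 * pd g i z ^ 2 ≤ 0 := fun i => by
    apply mul_nonpos_of_nonpos_of_nonneg _ (sq_nonneg _)
    exact div_nonpos_of_nonpos_of_nonneg (by linarith) (pow_nonneg (hp z).le 3)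
  have n0 := hneg 0
  have n1 := hneg 1
  unfold Lop lap2
  rw [Fin.sum_univ_two, Fin.sum_univ_two, e2, e2, e1, e1]
  linarith

lemma mk_sup {w : ℝ → E2 → ℝ} {s1 δ : ℝ} (hδ : 0 < δ)
    (hpos : ∀ s, s1 ≤ s → ∀ y, 0 ≤ w s y)
    (hreg : ∀ s, s1 ≤ s → ContDiff ℝ 2 (w s))
    (heq : ∀ s, s1 ≤ s → ∀ y, HasDerivAt (fun τ => w τ y)
        (lap2 (w s) y - (1 / 2) * (y 0 * pd (w s) 0 y + y 1 * pd (w s) 1 y)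
          - w s y + (w s y) ^ 2) s) :
    SupSol (fun t z => hh δ (w (max t s1) z)) (1 / δ) s1 := by
  have hm : ∀ t, s1 ≤ max t s1 := fun t => le_max_right _ _
  have hp : ∀ t z, 0 < 1 + δ * w (max t s1) z := fun t z => by
    have := mul_nonneg hδ.le (hpos _ (hm t) z); linarith
  refine ⟨fun t z => div_nonneg (hpos _ (hm t) z) (hp t z).le, fun t z => ?_, fun t => ?_, fun z => ?_,
    fun t ht z => ?_⟩
  · unfold hh
    rw [div_le_div_iff₀ (hp t z) hδ]
    linarith
  · unfold hh
    have := hreg _ (hm t)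
    exact this.div (contDiff_const.add (contDiff_const.mul this)) fun z => (hp t z).ne'
  · rw [continuous_iff_continuousAt]
    intro t
    have c1 : ContinuousAt (fun τ => w τ z) (max t s1) := (heq _ (hm t) z).continuousAt
    have c2 : ContinuousAt (fun t => w (max t s1) z) t :=
      ContinuousAt.comp (f := fun t => max t s1) (g := fun τ => w τ z) c1
        (continuous_id.max continuous_const).continuousAt
    exact ContinuousAt.comp (f := fun t => w (max t s1) z) (g := hh δ)
      (hh_deriv (hp t z).ne').continuousAt c2
  · have emax : max t s1 = t := max_eq_left ht
    have hpt := hp t z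
    rw [emax] at hpt
    have hd := (hh_deriv hpt.ne').comp t (heq t ht z)
    refine ⟨_, hd.hasDerivWithinAt.congr (fun τ hτ => ?_) ?_, ?_⟩
    · rw [max_eq_left (ht.trans (le_of_lt hτ))]; rfl
    · rw [emax]; rfl
    · simp only [emax]
      have := hh_Lop hδ (hreg t ht) (hpos t ht) z
      unfold Lop at this ⊢
      exact this

lemma final_contra
    (w : ℝ → (Fin 2 → ℝ) → ℝ) (s₁ : ℝ)
    (hpos : ∀ s, s₁ ≤ s → ∀ y, 0 ≤ w s y)
    (hreg : ∀ s, s₁ ≤ s → ContDiff ℝ 2 (w s))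
    (hint : ∀ s, s₁ ≤ s → Integrable (fun y : Fin 2 → ℝ => w s y * rho2 y))
    (heq : ∀ s, s₁ ≤ s → ∀ y, HasDerivAt (fun τ => w τ y)
        (lap2 (w s) y - (1 / 2) * (y 0 * pd (w s) 0 y + y 1 * pd (w s) 1 y)
          - w s y + (w s y) ^ 2) s)
    (hinit : 1 < ∫ y : Fin 2 → ℝ, w s₁ y * rho2 y) :
    False := by
  have cw := (hreg s₁ le_rfl).continuous
  have cr := (rho_cd (n := 0)).continuous
  have hp : ∀ (n : ℕ) z, 0 < 1 + (1 / ((n : ℝ) + 1)) * w s₁ z := fun n z => by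
    have := mul_nonneg (show (0:ℝ) ≤ 1 / ((n:ℝ) + 1) by positivity) (hpos _ le_rfl z); linarith
  have T : Tendsto (fun n : ℕ => ∫ z, hh (1 / ((n : ℝ) + 1)) (w s₁ z) * rho2 z) atTop
      (𝓝 (∫ y : Fin 2 → ℝ, w s₁ y * rho2 y)) := by
    apply tendsto_integral_of_dominated_convergence (fun z => w s₁ z * rho2 z)
    · intro n
      unfold hh
      refine Continuous.aestronglyMeasurable (Continuous.mul (Continuous.div cw (by fun_prop) ?_) cr)
      exact fun z => (hp n z).ne'
    · exact hint s₁ le_rfl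
    · intro n
      refine ae_of_all _ fun z => ?_
      have h0 := hpos _ le_rfl z
      have h1 : 0 ≤ hh (1 / ((n : ℝ) + 1)) (w s₁ z) := div_nonneg h0 (hp n z).le
      rw [Real.norm_eq_abs, abs_of_nonneg (mul_nonneg h1 (rho_pos z).le)]
      refine mul_le_mul_of_nonneg_right (div_le_self h0 ?_) (rho_pos z).le
      have := mul_nonneg (show (0:ℝ) ≤ 1 / ((n:ℝ) + 1) by positivity) h0
      linarith
    · refine ae_of_all _ fun z => ?_
      have h1 := tendsto_one_div_add_atTop_nhds_zero_nat (𝕜 := ℝ)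
      have h2 := (h1.mul_const (w s₁ z)).const_add 1
      have h3 := (tendsto_const_nhds (x := w s₁ z)).div h2 (by simp)
      have h4 := h3.mul_const (rho2 z)
      simpa [hh] using h4
  obtain ⟨n, hn⟩ := (T.eventually (Ioi_mem_nhds hinit)).exists
  refine sup_contra (mk_sup (δ := 1 / ((n : ℝ) + 1)) (by positivity) hpos hreg heq) ?_
  simp only [max_self]
  exact hn

/-- **Blow-up criterion for nonnegative solutions of the similarity-variables equation
(`p = 2`).** If `w ≥ 0` solves `∂_s w = Δw - (1/2) y·∇w - w + w²` for all `s ≥ s₁` and all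
`y ∈ ℝ²`, and `w_{0,0}(s₁) = ∫ w(y,s₁) ρ(y) dy > 1`, then `w` cannot be defined for all
`(y,s) ∈ ℝ² × [s₁,∞)`; i.e. such a global-in-`s` solution does not exist. -/
theorem blowup_criterion_nonneg
    (w : ℝ → (Fin 2 → ℝ) → ℝ) (s₁ : ℝ)
    (hpos : ∀ s, s₁ ≤ s → ∀ y, 0 ≤ w s y)
    (hreg : ∀ s, s₁ ≤ s → ContDiff ℝ 2 (w s))
    (hint : ∀ s, s₁ ≤ s → Integrable (fun y : Fin 2 → ℝ => w s y * rho2 y))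
    (heq : ∀ s, s₁ ≤ s → ∀ y, HasDerivAt (fun τ => w τ y)
        (lap2 (w s) y - (1 / 2) * (y 0 * pd (w s) 0 y + y 1 * pd (w s) 1 y)
          - w s y + (w s y) ^ 2) s)
    (hinit : 1 < ∫ y : Fin 2 → ℝ, w s₁ y * rho2 y) :
    False := by
  exact final_contra w s₁ hpos hreg hint heq hinit

end
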